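/- For every integer n ≥ 0, the dimension of the degree-n graded component of A = R/I equals H(n) = (5n⁴ + 160n³ + 2107n² + 13232n + 38760) · (n+7)(n+8)(n+9) · (n+1)(n+2)⋯(n+15) / (5·2·3·7·19!). In particular the Hilbert polynomial of X = Proj A has degree 22. -/

import Mathlib

set_option synthInstance.maxHeartbeats 1000000
set_option maxHeartbeats 2000000

noncomputable section

/-- The polynomial ring `R` over `ℂ` in the 32 variables `λ_S`, `S ⊆ {1,…,5}`. -/
abbrev R32 : Type := MvPolynomial (Finset (Fin 5)) ℂ

/-- The exterior algebra `Λ(V) ⊗ R` of `V = ℂ⁵` with polynomial coefficients. -/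
abbrev Ext5 : Type := ExteriorAlgebra R32 (Fin 5 → R32)

/-- The basis wedge monomial `e_S = e_{s₁} ∧ ⋯ ∧ e_{s_k}` for `S = {s₁ < ⋯ < s_k}`. -/
def eS (S : Finset (Fin 5)) : Ext5 :=
  ((S.sort (· ≤ ·)).map fun s => ExteriorAlgebra.ι R32 (Pi.single s 1)).prod

/-- The degree-`k` component `λ_k = Σ_{|S| = k} λ_S e_S` of the generic spinor. -/
def lamb (k : ℕ) : Ext5 :=
  ∑ S ∈ Finset.univ.filter (fun S : Finset (Fin 5) => S.card = k),
    (MvPolynomial.X S : R32) • eS S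

/-- Contraction `ι_r` with the `r`-th dual basis vector. -/
def ctr (r : Fin 5) : Ext5 →ₗ[R32] Ext5 :=
  CliffordAlgebra.contractLeft (Q := (0 : QuadraticForm R32 (Fin 5 → R32))) (LinearMap.proj r)

/-- Equation (E1): `λ₀λ₅ + λ₁∧λ₄ − λ₂∧λ₃ = 0` in `Λ⁵V`. -/
def E1 : Ext5 := (MvPolynomial.X ∅ : R32) • lamb 5 + lamb 1 * lamb 4 - lamb 2 * lamb 3

/-- Equation (E2): `−2λ₀λ₄ − 2λ₁∧λ₃ + λ₂∧λ₂ = 0` in `Λ⁴V`. -/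
def E2 : Ext5 :=
  -(2 • ((MvPolynomial.X ∅ : R32) • lamb 4)) - 2 • (lamb 1 * lamb 3) + lamb 2 * lamb 2

/-- Equation (E3): `−2ι_r(λ₁)λ₅ + 2ι_r(λ₂)∧λ₄ + ι_r(λ₃)∧λ₃ = 0` in `Λ⁵V`, `r = 1,…,5`. -/
def E3 (r : Fin 5) : Ext5 :=
  -(2 • (ctr r (lamb 1) * lamb 5)) + 2 • (ctr r (lamb 2) * lamb 4) + ctr r (lamb 3) * lamb 3

/-- The ideal `I ⊆ R` generated by the 11 coefficients of the expressions (E1), (E2), (E3):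
equivalently, the smallest ideal `J` such that each of the expressions lies in the submodule
`J • Λ(V)` of the (free) `R`-module `Λ(V) ⊗ R`. -/
def Igrav : Ideal R32 :=
  sInf {J : Ideal R32 |
    E1 ∈ J • (⊤ : Submodule R32 Ext5) ∧ E2 ∈ J • (⊤ : Submodule R32 Ext5) ∧
    ∀ r : Fin 5, E3 r ∈ J • (⊤ : Submodule R32 Ext5)}

/-- The degree-`n` graded component `A_n` of `A = R/I` (the image in `R/I` of the space of
homogeneous polynomials of degree `n`). -/
def Acomp (n : ℕ) : Submodule ℂ (R32 ⧸ Igrav) :=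
  (MvPolynomial.homogeneousSubmodule (Finset (Fin 5)) ℂ n).map
    (Ideal.Quotient.mkₐ ℂ Igrav).toLinearMap

set_option linter.all false

/-- Integer polynomials as lists of terms: packed exponent code, coefficient. -/
inductive PL : Type
  | nil : PL
  | cons (m : ℕ) (c : ℤ) (t : PL) : PL

namespace PL

/-- Merge-addition of two term lists. -/
def add (p : PL) : PL → PL :=
  PL.rec (motive := fun _ => PL → PL) (fun q => q)
    (fun m c t ih q =>
      PL.rec (motive := fun _ => PL) (PL.cons m c t)
        (fun m' c' t' ih' =>
          bif Nat.blt m m' then PL.cons m c (ih (PL.cons m' c' t'))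
          else bif Nat.blt m' m then PL.cons m' c' ih'
          else bif (c + c' == 0) then ih t'
          else PL.cons m (c + c') (ih t')) q) p

/-- Multiplication of a term list by a term. -/
def smul (q : ℕ) (d : ℤ) (p : PL) : PL :=
  PL.rec (motive := fun _ => PL) PL.nil (fun m c _ ih => PL.cons (m + q) (d * c) ih) p

end PL

/-- The bit mask with an 8 in each of the 32 hexadecimal digits. -/
def msk : ℕ := 181483929024500513847133123963609712776

/-- Look for a divisor of `m` among the leading codes in `G`, and continue with
the cofactor and the tail. -/
def findDiv (m : ℕ) (k : ℕ → PL → Option PL) (G : List (ℕ × PL)) : Option PL :=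
  List.rec (motive := fun _ => Option PL) none
    (fun g _ ih => bif Nat.ble g.1 m && Nat.beq (Nat.land (m - g.1) msk) 0
      then k (m - g.1) g.2 else ih) G

/-- Reduction to zero of a term list modulo `G`. -/
def red (G : List (ℕ × PL)) (fuel : ℕ) : PL → Bool :=
  Nat.rec (motive := fun _ => PL → Bool) (fun _ => false)
    (fun _ ih p =>
      PL.rec (motive := fun _ => Bool) true
        (fun m c t _ =>
          Option.rec (motive := fun _ => Bool) false (fun p' => ih p')
            (findDiv m (fun q g => some (PL.add t (PL.smul q (-c) g))) G)) p) fuel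

/-! ### Monomial codes -/

/-- The table of variable positions, indexed by the bit mask of the subset. -/
def posTab : List (Fin 32) := [9, 26, 2, 10, 27, 7, 1, 24, 21, 14, 4, 5, 13, 15, 18, 22, 11, 3, 12, 0, 8, 17, 23, 29, 6, 25, 31, 20, 30, 28, 19, 16]

/-- The position of a variable. -/
def posF (S : Finset (Fin 5)) : Fin 32 := posTab.getD (∑ i ∈ S, 2 ^ (i : ℕ)) 0

theorem posF_bij : Function.Bijective posF := by
  rw [Fintype.bijective_iff_injective_and_card]
  refine ⟨?_, by simp⟩
  rw [Function.Injective]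
  decide +kernel

/-- The position of a variable, as an equivalence. -/
def pe : Finset (Fin 5) ≃ Fin 32 := Equiv.ofBijective posF posF_bij

theorem pe_apply (S : Finset (Fin 5)) : pe S = posF S := rfl

/-- The exponent vectors. -/
abbrev Mon : Type := Finset (Fin 5) →₀ ℕ

/-- Hexadecimal digits. -/
def dig (c p : ℕ) : ℕ := c / 16 ^ p % 16

/-- The exponent vector of a code. -/
def dec (c : ℕ) : Mon := Finsupp.equivFunOnFinite.symm fun S => dig c (pe S)

theorem dec_apply (c : ℕ) (S : Finset (Fin 5)) : dec c S = dig c (pe S) := rfl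

/-- All 32 digits are at most seven. -/
def okc (c : ℕ) : Prop := Nat.land c msk = 0

theorem okc_dig {c : ℕ} (h : okc c) {p : ℕ} (hp : p < 32) : dig c p < 8 := by
  have h1 : (c &&& msk).testBit (4 * p + 3) = false := by
    have : c &&& msk = 0 := h
    rw [this, Nat.zero_testBit]
  rw [Nat.testBit_and] at h1
  have h2 : msk.testBit (4 * p + 3) = true := by
    have : ∀ p : Fin 32, msk.testBit (4 * (p : ℕ) + 3) = true := by decide +kernel
    exact this ⟨p, hp⟩
  rw [h2, Bool.and_true, Nat.testBit_eq_decide_div_mod_eq] at h1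
  have h3 : 2 ^ (4 * p + 3) = 16 ^ p * 8 := by
    rw [pow_add, pow_mul]; norm_num
  rw [h3, ← Nat.div_div_eq_div_mul] at h1
  unfold dig
  simp only [decide_eq_false_iff_not] at h1
  omega

theorem div_add_ok {a b : ℕ} (ha : okc a) (hb : okc b) {p : ℕ} (hp : p ≤ 32) :
    (a + b) / 16 ^ p = a / 16 ^ p + b / 16 ^ p := by
  induction p with
  | zero => simp
  | succ p ih =>
    have h := ih (by omega)
    have h1 := okc_dig ha (p := p) (by omega)
    have h2 := okc_dig hb (p := p) (by omega)
    unfold dig at h1 h2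
    rw [pow_succ, ← Nat.div_div_eq_div_mul, ← Nat.div_div_eq_div_mul, ← Nat.div_div_eq_div_mul, h]
    omega

theorem dec_add {a b : ℕ} (ha : okc a) (hb : okc b) : dec (a + b) = dec a + dec b := by
  ext S
  rw [Finsupp.add_apply, dec_apply, dec_apply, dec_apply]
  have h1 := okc_dig ha (pe S).isLt
  have h2 := okc_dig hb (pe S).isLt
  have h := div_add_ok ha hb (pe S).isLt.le
  unfold dig at *
  rw [h]
  omega

/-- The weight of a variable position. -/
def wv (p : ℕ) : ℕ := 16 ^ 32 - 16 ^ p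

/-- The weight of a monomial (this refines the graded reverse lexicographic order). -/
def wt (e : Mon) : ℕ := ∑ S, e S * wv (pe S)

/-- The degree of a monomial. -/
def dg (e : Mon) : ℕ := ∑ S, e S

theorem wt_add (a b : Mon) : wt (a + b) = wt a + wt b := by
  simp [wt, add_mul, Finset.sum_add_distrib]

theorem dg_add (a b : Mon) : dg (a + b) = dg a + dg b := by
  simp [dg, Finset.sum_add_distrib]

/-- The weight of a code. -/
def wtc (c : ℕ) : ℕ := ((List.range 32).map fun p => dig c p * wv p).sum

/-- The degree of a code. -/
def dgc (c : ℕ) : ℕ := ((List.range 32).map fun p => dig c p).sum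

theorem wt_dec (c : ℕ) : wt (dec c) = wtc c := by
  have h : wt (dec c) = ∑ p : Fin 32, dig c p * wv p :=
    Equiv.sum_comp pe (fun p : Fin 32 => dig c p * wv p)
  rw [h, Finset.sum_range (fun p => dig c p * wv p) |>.symm]
  rfl

theorem dg_dec (c : ℕ) : dg (dec c) = dgc c := by
  have h : dg (dec c) = ∑ p : Fin 32, dig c p :=
    Equiv.sum_comp pe (fun p : Fin 32 => dig c p)
  rw [h, Finset.sum_range (fun p => dig c p) |>.symm]
  rfl

/-! ### Evaluation of term lists -/

section evaluation

open MvPolynomial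

/-- The polynomial given by a term list. -/
def ev : PL → R32
  | .nil => 0
  | .cons m c t => monomial (dec m) (c : ℂ) + ev t

/-- All terms satisfy a predicate. -/
def PL.All (P : ℕ → Prop) : PL → Prop
  | .nil => True
  | .cons m _ t => P m ∧ PL.All P t

theorem PL.add_nil_left (q : PL) : PL.add .nil q = q := rfl

theorem PL.add_nil_right (p : PL) : PL.add p .nil = p := by cases p <;> rfl

theorem PL.add_cons (m m' : ℕ) (c c' : ℤ) (t t' : PL) :
    PL.add (.cons m c t) (.cons m' c' t') =
      bif Nat.blt m m' then PL.cons m c (PL.add t (PL.cons m' c' t'))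
      else bif Nat.blt m' m then PL.cons m' c' (PL.add (.cons m c t) t')
      else bif (c + c' == 0) then PL.add t t'
      else PL.cons m (c + c') (PL.add t t') := rfl

theorem PL.smul_cons (q : ℕ) (d : ℤ) (m : ℕ) (c : ℤ) (t : PL) :
    PL.smul q d (.cons m c t) = .cons (m + q) (d * c) (PL.smul q d t) := rfl

theorem blt_false_eq {m m' : ℕ} (h : Nat.blt m m' = false) (h' : Nat.blt m' m = false) :
    m = m' := by
  have h1 : ¬ m < m' := by rw [← Nat.blt_eq, h]; simp
  have h2 : ¬ m' < m := by rw [← Nat.blt_eq, h']; simp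
  omega

theorem ev_add (p q : PL) : ev (PL.add p q) = ev p + ev q := by
  induction p generalizing q with
  | nil => simp [PL.add_nil_left, ev]
  | cons m c t ih =>
    induction q with
    | nil => simp [PL.add_nil_right, ev]
    | cons m' c' t' ih' =>
      rw [PL.add_cons]
      cases h1 : Nat.blt m m' with
      | true => simp only [cond_true, ev, ih]; ring
      | false =>
        cases h2 : Nat.blt m' m with
        | true => simp only [cond_true, cond_false, ev, ih']; ring
        | false =>
          have hm := blt_false_eq h1 h2
          subst hm
          have hmon : (monomial (dec m) ((c + c' : ℤ) : ℂ) : R32) =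
              monomial (dec m) (c : ℂ) + monomial (dec m) (c' : ℂ) := by
            rw [← map_add]; push_cast; rfl
          cases h3 : (c + c' == 0) with
          | true =>
            have h4 : c + c' = 0 := by simpa using h3
            rw [h4] at hmon
            simp only [Int.cast_zero, map_zero] at hmon
            simp only [cond_true, cond_false, ev, ih]
            linear_combination hmon
          | false =>
            simp only [cond_false, ev, ih, hmon]; ring

theorem all_add {P : ℕ → Prop} {p q : PL} (hp : p.All P) (hq : q.All P) : (PL.add p q).All P := by
  induction p generalizing q with
  | nil => exact hq
  | cons m c t ih =>
    induction q with
    | nil => exact hp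
    | cons m' c' t' ih' =>
      rw [PL.add_cons]
      cases h1 : Nat.blt m m' with
      | true => exact ⟨hp.1, ih hp.2 hq⟩
      | false =>
        cases h2 : Nat.blt m' m with
        | true => exact ⟨hq.1, ih' hq.2⟩
        | false =>
          cases h3 : (c + c' == 0) with
          | true => exact ih hp.2 hq.2
          | false => exact ⟨hp.1, ih hp.2 hq.2⟩

theorem ev_smul {q : ℕ} (hq : okc q) (d : ℤ) {p : PL} (hp : p.All okc) :
    ev (PL.smul q d p) = monomial (dec q) (d : ℂ) * ev p := by
  induction p with
  | nil => simp [PL.smul, ev]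
  | cons m c t ih =>
    rw [PL.smul_cons]
    simp only [ev, ih hp.2, mul_add, monomial_mul, dec_add hp.1 hq]
    congr 2
    · rw [add_comm]
    · push_cast; rfl

theorem all_smul {P : ℕ → Prop} {q : ℕ} (d : ℤ) {p : PL} (hp : p.All fun m => P (m + q)) :
    (PL.smul q d p).All P := by
  induction p with
  | nil => trivial
  | cons m c t ih => exact ⟨hp.1, ih hp.2⟩

theorem PL.All.mono {P Q : ℕ → Prop} {p : PL} (hp : p.All P) (h : ∀ m, P m → Q m) : p.All Q := by
  induction p with
  | nil => trivial
  | cons m c t ih => exact ⟨h _ hp.1, ih hp.2⟩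

theorem PL.All.and {P Q : ℕ → Prop} {p : PL} (hp : p.All P) (hq : p.All Q) :
    p.All fun m => P m ∧ Q m := by
  induction p with
  | nil => trivial
  | cons m c t ih => exact ⟨⟨hp.1, hq.1⟩, ih hp.2 hq.2⟩

theorem ev_support {P : Mon → Prop} {p : PL} (hp : p.All fun m => P (dec m)) :
    ∀ u ∈ (ev p).support, P u := by
  induction p with
  | nil => simp [ev]
  | cons m c t ih =>
    intro u hu
    rcases Finset.mem_union.1 (MvPolynomial.support_add hu) with h | h
    · have := Finset.mem_singleton.1 (MvPolynomial.support_monomial_subset h)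
      rw [this]; exact hp.1
    · exact ih hp.2 u h

theorem findDiv_spec {m : ℕ} {k : ℕ → PL → Option PL} {G : List (ℕ × PL)} {r : PL}
    (h : findDiv m k G = some r) :
    ∃ g ∈ G, ∃ q, m = q + g.1 ∧ okc q ∧ k q g.2 = some r := by
  induction G with
  | nil => simp [findDiv] at h
  | cons g G ih =>
    have hh : findDiv m k (g :: G) = bif Nat.ble g.1 m && Nat.beq (Nat.land (m - g.1) msk) 0
      then k (m - g.1) g.2 else findDiv m k G := rfl
    rw [hh] at h
    cases hb : (Nat.ble g.1 m && Nat.beq (Nat.land (m - g.1) msk) 0) with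
    | true =>
      rw [hb, cond_true] at h
      rw [Bool.and_eq_true] at hb
      have h1 := Nat.le_of_ble_eq_true hb.1
      exact ⟨g, by simp, m - g.1, by omega, Nat.eq_of_beq_eq_true hb.2, h⟩
    | false =>
      rw [hb, cond_false] at h
      obtain ⟨g', hg', q, h1⟩ := ih h
      exact ⟨g', by simp [hg'], q, h1⟩

/-- The polynomial given by a leading code and a tail. -/
def gpoly (g : ℕ × PL) : R32 := monomial (dec g.1) 1 + ev g.2

theorem red_sound {G : List (ℕ × PL)} (hG : ∀ g ∈ G, okc g.1 ∧ g.2.All okc)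
    (N : Submodule ℂ R32) (m' : Mon) (P : Mon → Prop)
    (hN : ∀ g ∈ G, ∀ q : Mon, P (q + dec g.1) → monomial (m' + q) 1 * gpoly g ∈ N)
    (hP : ∀ g ∈ G, ∀ q : Mon, P (q + dec g.1) → g.2.All fun t => P (q + dec t))
    (fuel : ℕ) (p : PL) (hp : p.All fun m => P (dec m)) (h : red G fuel p = true) :
    monomial m' 1 * ev p ∈ N := by
  induction fuel generalizing p with
  | zero => simp [red] at h
  | succ n ih =>
    cases p with
    | nil => simp [ev]
    | cons m c t =>
      have hr : red G (n + 1) (PL.cons m c t) = Option.rec (motive := fun _ => Bool) false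
        (fun p' => red G n p')
            (findDiv m (fun q g => some (PL.add t (PL.smul q (-c) g))) G) := rfl
      rw [hr] at h
      cases hf : findDiv m (fun q g => some (PL.add t (PL.smul q (-c) g))) G with
      | none => rw [hf] at h; simp at h
      | some r =>
        rw [hf] at h
        obtain ⟨g, hg, q, hm, hq, hk⟩ := findDiv_spec hf
        simp only [Option.some.injEq] at hk
        have hdm : dec m = dec q + dec g.1 := by rw [hm, dec_add hq (hG g hg).1]
        have hpm : P (dec q + dec g.1) := hdm ▸ hp.1
        have hall : r.All fun m => P (dec m) := by
          rw [← hk]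
          refine all_add hp.2 (all_smul _ ?_)
          refine ((hG g hg).2.and (hP g hg _ hpm)).mono ?_
          rintro x ⟨hx, hx'⟩
          rw [dec_add hx hq, add_comm]
          exact hx'
        have h1 := ih r hall h
        have h2 := N.smul_mem (c : ℂ) (hN g hg _ hpm)
        have h3 := N.add_mem h1 h2
        convert h3 using 1
        rw [← hk, ev_add, ev_smul hq _ (hG g hg).2, ev, hdm, gpoly]
        have e1 : (monomial (dec q + dec g.1) (c : ℂ) : R32) =
          C (c : ℂ) * (monomial (dec q) 1 * monomial (dec g.1) 1) := by
          rw [monomial_mul, C_mul_monomial]; simp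
        have e2 : (monomial (dec q) ((-c : ℤ) : ℂ) : R32) = - (C (c : ℂ) * monomial (dec q) 1) := by
          rw [C_mul_monomial, ← map_neg]; simp
        have e3 : (monomial (m' + dec q) (1 : ℂ) : R32) = monomial m' 1 * monomial (dec q) 1 := by
          rw [monomial_mul]; simp
        rw [e1, e2, e3, MvPolynomial.smul_eq_C_mul]
        ring

end evaluation

/-! ### The standard monomial theorem -/

section groebner

open MvPolynomial

variable {N : ℕ} (l : Fin N → Mon) (t : Fin N → R32)

/-- The standard monomials. -/
def IsStd (m : Mon) : Prop := ∀ j, ¬ l j ≤ m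

/-- The span of a triangular system of multiples of the given polynomials. -/
def Bsub : Submodule ℂ R32 :=
  Submodule.span ℂ (Set.range fun x : {x : Mon × Fin N // ∀ i < x.2, ¬ l i ≤ x.1 + l x.2} =>
    monomial x.1.1 1 * (monomial (l x.1.2) 1 + t x.1.2))

/-- The reduction hypothesis for an S-polynomial. -/
def Reduces (f : R32) (W : ℕ) : Prop :=
  ∀ (N' : Submodule ℂ R32) (m' : Mon),
    (∀ (q : Mon) (k : Fin N), wt (q + l k) < W →
      monomial (m' + q) 1 * (monomial (l k) 1 + t k) ∈ N') → monomial m' 1 * f ∈ N'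

variable {l t}

theorem mem_Bsub
    (hb : ∀ i j : Fin N, i < j → ∀ m, l i ≤ m + l j → ∃ i' < j, ∃ q' r, q' ≤ m ∧
      q' + l j = r + l i' ∧
      Reduces l t (monomial q' 1 * t j - monomial r 1 * t i') (wt (q' + l j))) :
    ∀ (W : ℕ) (j : Fin N) (m : Mon), wt (m + l j) = W →
      monomial m 1 * (monomial (l j) 1 + t j) ∈ Bsub l t := by
  intro W
  induction W using Nat.strong_induction_on with
  | _ W ihW =>
    intro j
    induction j using WellFoundedLT.induction with
    | _ j ihj =>
      intro m hm
      by_cases hs : ∀ i < j, ¬ l i ≤ m + l j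
      · exact Submodule.subset_span ⟨⟨(m, j), hs⟩, rfl⟩
      · push Not at hs
        obtain ⟨i, hij, hi⟩ := hs
        obtain ⟨i', hi', q', r, hq', hqr, hred⟩ := hb i j hij m hi
        obtain ⟨m', rfl⟩ := exists_add_of_le hq'
        have h1 : monomial (m' + r) 1 * (monomial (l i') 1 + t i') ∈ Bsub l t := by
          refine ihj i' hi' (m' + r) ?_
          rw [← hm, add_assoc, ← hqr, ← add_assoc, add_comm m']
        have h2 := hred (Bsub l t) m' (fun q k hlt => ihW _ ?_ k _ rfl)
        · have h3 := Submodule.add_mem _ h1 h2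
          convert h3 using 1
          have e1 : (monomial (q' + m') (1 : ℂ) : R32) = monomial m' 1 * monomial q' 1 := by
            rw [monomial_mul, add_comm]; simp
          have e2 : (monomial (m' + r) (1 : ℂ) : R32) = monomial m' 1 * monomial r 1 := by
            rw [monomial_mul]; simp
          have e3 : (monomial q' (1 : ℂ) * monomial (l j) 1 : R32) =
              monomial r 1 * monomial (l i') 1 := by
            rw [monomial_mul, monomial_mul, hqr]
          rw [e1, e2]
          linear_combination (monomial m' (1 : ℂ) : R32) * e3
        · rw [← hm]
          simp only [wt_add] at hlt ⊢
          omega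

theorem ideal_le_Bsub
    (hB : ∀ (j : Fin N) (m : Mon), monomial m 1 * (monomial (l j) 1 + t j) ∈ Bsub l t)
    {f : R32} (hf : f ∈ Ideal.span (Set.range fun j => monomial (l j) 1 + t j)) :
    f ∈ Bsub l t := by
  obtain ⟨c, rfl⟩ := Ideal.mem_span_range_iff_exists_fun.1 hf
  refine Submodule.sum_mem _ fun j _ => ?_
  generalize c j = a
  induction a using MvPolynomial.induction_on' with
  | monomial u a =>
    have := (Bsub l t).smul_mem a (hB j u)
    rwa [← smul_mul_assoc, smul_monomial, smul_eq_mul, mul_one] at this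
  | add p q hp hq => rw [add_mul]; exact Submodule.add_mem _ hp hq

theorem Bsub_std (ht : ∀ j, ∀ u ∈ (t j).support, wt u < wt (l j)) {f : R32}
    (hf : f ∈ Bsub l t) (hs : ∀ m, ¬ IsStd l m → coeff m f = 0) : f = 0 := by
  rw [Bsub, Finsupp.mem_span_range_iff_exists_finsupp] at hf
  obtain ⟨c, rfl⟩ := hf
  by_cases hc : c = 0
  · rw [hc]; simp
  exfalso
  obtain ⟨b, hbm, hmax⟩ := Finset.exists_max_image c.support (fun b => wt (b.1.1 + l b.1.2))
    (Finsupp.support_nonempty_iff.2 hc)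
  have h0 := hs (b.1.1 + l b.1.2) (fun h => h b.1.2 le_add_self)
  rw [Finsupp.sum, coeff_sum, Finset.sum_eq_single b] at h0
  · rw [coeff_smul, coeff_monomial_mul, one_mul, coeff_add, coeff_monomial, if_pos rfl] at h0
    have h1 : coeff (l b.1.2) (t b.1.2) = 0 := by
      by_contra hne
      exact (ht b.1.2 _ (mem_support_iff.2 hne)).ne rfl
    rw [h1, add_zero, smul_eq_mul, mul_one] at h0
    exact Finsupp.mem_support_iff.1 hbm h0
  · intro b' hb' hne
    rw [coeff_smul, mul_add, coeff_add, monomial_mul, coeff_monomial, if_neg, zero_add,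
      coeff_monomial_mul']
    · split_ifs with hle
      · obtain ⟨u, hu⟩ := exists_add_of_le hle
        have hsub : b.1.1 + l b.1.2 - b'.1.1 = u := by rw [hu]; simp
        rw [hsub]
        have : coeff u (t b'.1.2) = 0 := by
          by_contra hne'
          have h1 := ht b'.1.2 _ (mem_support_iff.2 hne')
          have h2 := hmax b' hb'
          rw [hu] at h2
          simp only [wt_add] at h2
          omega
        rw [this]; simp
      · simp
    · intro heq
      apply hne
      have key : ∀ x y : {x : Mon × Fin N // ∀ i < x.2, ¬ l i ≤ x.1 + l x.2},
          x.1.1 + l x.1.2 = y.1.1 + l y.1.2 → ¬ x.1.2 < y.1.2 := by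
        intro x y hxy hlt
        refine y.2 _ hlt ?_
        rw [← hxy]
        exact le_add_self
      have h1 := key b' b heq
      have h2 := key b b' heq.symm
      have h3 : b'.1.2 = b.1.2 := le_antisymm (not_lt.1 h2) (not_lt.1 h1)
      rw [h3] at heq
      exact Subtype.ext (Prod.ext (add_right_cancel heq) h3)
  · intro h; exact absurd hbm h

theorem std_span (I : Ideal R32) (hI : ∀ j, monomial (l j) 1 + t j ∈ I)
    (ht : ∀ j, ∀ u ∈ (t j).support, wt u < wt (l j) ∧ dg u = dg (l j)) (n : ℕ) :
    ∀ (W : ℕ) (m : Mon), wt m = W → dg m = n →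
      Ideal.Quotient.mkₐ ℂ I (monomial m 1) ∈ Submodule.span ℂ
        (Set.range fun x : {m : Mon // dg m = n ∧ IsStd l m} =>
          Ideal.Quotient.mkₐ ℂ I (monomial x.1 1)) := by
  intro W
  induction W using Nat.strong_induction_on with
  | _ W ih =>
    intro m hW hn
    by_cases hs : IsStd l m
    · exact Submodule.subset_span ⟨⟨m, hn, hs⟩, rfl⟩
    · unfold IsStd at hs
      push Not at hs
      obtain ⟨j, hj⟩ := hs
      obtain ⟨m', rfl⟩ := exists_add_of_le hj
      have h1 : Ideal.Quotient.mkₐ ℂ I (monomial (l j + m') 1) =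
          - Ideal.Quotient.mkₐ ℂ I (monomial m' 1 * t j) := by
        rw [← map_neg]
        refine Ideal.Quotient.eq.2 ?_
        have := I.mul_mem_left (monomial m' 1) (hI j)
        convert this using 1
        have e : (monomial (l j + m') (1 : ℂ) : R32) = monomial m' 1 * monomial (l j) 1 := by
          rw [monomial_mul, add_comm]; simp
        rw [e]; ring
      rw [h1]
      refine Submodule.neg_mem _ ?_
      have h2 : monomial m' 1 * t j = ∑ u ∈ (t j).support,
          (coeff u (t j)) • (monomial (m' + u) (1 : ℂ) : R32) := by
        conv_lhs => rw [(t j).as_sum]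
        rw [Finset.mul_sum]
        refine Finset.sum_congr rfl fun u _ => ?_
        rw [monomial_mul, smul_monomial]; simp
      rw [h2, map_sum]
      refine Submodule.sum_mem _ fun u hu => ?_
      rw [map_smul]
      refine Submodule.smul_mem _ _ (ih _ ?_ _ rfl ?_)
      · have := (ht j u hu).1
        rw [← hW]
        simp only [wt_add]
        omega
      · have := (ht j u hu).2
        rw [← hn]
        simp only [dg_add]
        omega

theorem homog_mem_span (n : ℕ) {f : R32} (hf : f ∈ homogeneousSubmodule (Finset (Fin 5)) ℂ n) :
    f ∈ Submodule.span ℂ (Set.range fun x : {m : Mon // dg m = n} =>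
      (monomial x.1 1 : R32)) := by
  rw [f.as_sum]
  refine Submodule.sum_mem _ fun u hu => ?_
  have h1 : dg u = n := by
    have h := (mem_homogeneousSubmodule _ _).1 hf (mem_support_iff.1 hu)
    rw [← h, dg, Finsupp.weight_apply, Finsupp.sum_fintype] <;> simp
  have h2 := Submodule.smul_mem _ (coeff u f) (Submodule.subset_span
    (s := Set.range fun x : {m : Mon // dg m = n} => (monomial x.1 1 : R32)) ⟨⟨u, h1⟩, rfl⟩)
  simpa [smul_monomial] using h2

theorem finrank_Acomp_eq
    (hI : Igrav = Ideal.span (Set.range fun j => monomial (l j) 1 + t j))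
    (ht : ∀ j, ∀ u ∈ (t j).support, wt u < wt (l j) ∧ dg u = dg (l j))
    (hb : ∀ i j : Fin N, i < j → ∀ m, l i ≤ m + l j → ∃ i' < j, ∃ q' r, q' ≤ m ∧
      q' + l j = r + l i' ∧
      Reduces l t (monomial q' 1 * t j - monomial r 1 * t i') (wt (q' + l j)))
    (n : ℕ) (F : Finset Mon) (hF : ∀ m, m ∈ F ↔ dg m = n ∧ IsStd l m) :
    Module.finrank ℂ (Acomp n) = F.card := by
  have hB := fun j m => mem_Bsub hb _ j m rfl
  set v : {m : Mon // dg m = n ∧ IsStd l m} → R32 ⧸ Igrav :=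
    fun x => Ideal.Quotient.mkₐ ℂ Igrav (monomial x.1 1) with hv
  have hspan : Acomp n = Submodule.span ℂ (Set.range v) := by
    apply le_antisymm
    · rintro _ ⟨f, hf, rfl⟩
      have h1 := homog_mem_span n hf
      have h2 := Submodule.mem_map_of_mem (f := (Ideal.Quotient.mkₐ ℂ Igrav).toLinearMap) h1
      rw [Submodule.map_span] at h2
      refine Submodule.span_le.2 ?_ h2
      rintro _ ⟨_, ⟨x, rfl⟩, rfl⟩
      exact std_span Igrav (fun j => hI ▸ Ideal.subset_span ⟨j, rfl⟩) ht n _ x.1 rfl x.2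
    · refine Submodule.span_le.2 ?_
      rintro _ ⟨x, rfl⟩
      refine ⟨monomial x.1 1, ?_, rfl⟩
      refine isHomogeneous_monomial 1 ?_
      rw [Finsupp.degree_eq_sum]; exact x.2.1
  have hlin : LinearIndependent ℂ v := by
    have h1 : LinearIndependent ℂ
        (fun x : {m : Mon // dg m = n ∧ IsStd l m} => (monomial x.1 1 : R32)) := by
      have := (MvPolynomial.basisMonomials (Finset (Fin 5)) ℂ).linearIndependent.comp
        (fun x : {m : Mon // dg m = n ∧ IsStd l m} => x.1) Subtype.val_injective
      simpa [Function.comp_def] using this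
    refine h1.map (f := (Ideal.Quotient.mkₐ ℂ Igrav).toLinearMap) ?_
    rw [Submodule.disjoint_def]
    intro f hf hf'
    have hfI : f ∈ Igrav := Ideal.Quotient.eq_zero_iff_mem.1 hf'
    refine Bsub_std (fun j u hu => (ht j u hu).1) (ideal_le_Bsub hB (hI ▸ hfI)) ?_
    intro m hm
    clear hf' hfI
    induction hf using Submodule.span_induction with
    | mem x hx =>
      obtain ⟨y, rfl⟩ := hx
      rw [coeff_monomial, if_neg]
      rintro rfl
      exact hm y.2.2
    | zero => simp
    | add x y _ _ hx hy => rw [coeff_add, hx, hy, add_zero]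
    | smul a x _ hx => rw [coeff_smul, hx, smul_zero]
  let e : {m : Mon // dg m = n ∧ IsStd l m} ≃ F := Equiv.subtypeEquivRight fun m => (hF m).symm
  haveI : Fintype {m : Mon // dg m = n ∧ IsStd l m} := Fintype.ofEquiv _ e.symm
  rw [hspan, finrank_span_eq_card hlin, Fintype.card_congr e, Fintype.card_coe]

end groebner

/-! ### The Groebner basis -/

/-- The Groebner basis: leading codes and tails. -/
def GB : List (ℕ × PL) := [
  (4296015872,
    .cons 4503599627370497 (-1) <| .cons 1153202979583557632 (-1) <| .cons 18446744142429028352 (1) <|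
    .cons 295147905179352891392 (1) <| .cons 4722366482869645217792 (1) <|
    .cons 309485009821362660910825472 (1) <| .cons 4951760157213578693634424832 (-1) <|
    .cons 79228162514264337593560727552 (-1) <| .cons 1267650600228229401496703205392 (-1) <|
    .cons 20282409679209534149861574705152 (1) <| .cons 324518554867352546397785195282432 (1) <|
    .cons 5192296858534827628530496329220352 (-1) <| .cons 83076749755900055170322008062820352 (-1) <|
    .cons 1329227995784915872903808159791972352 (-1) <| .cons 21267647932558653966460912964753948672 (1) <|
    .nil),
  (16777232,
    .cons 4295032832 (-1) <| .cons 4785074604081152 (1) <| .cons 4722366500461831258112 (1) <|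
    .cons 75557863725983042895872 (-1) <| .cons 4971102970255355166391795712 (-1) <|
    .cons 1329227995784915872903807060280344832 (-1) <| .cons 21267972451112312393187696120506089472 (1) <|
    .nil),
  (285212672,
    .cons 4503599627374592 (1) <| .cons 72057598332895232 (-1) <| .cons 1152939096792891392 (1) <|
    .cons 19343108261739246148124672 (-1) <| .cons 325786204258654956184652723781632 (1) <|
    .cons 5192296858534827628530565048696832 (-1) <| .cons 1329248278194519524574231007531630592 (-1) <|
    .nil),
  (69632,
    .cons 1099528404992 (1) <| .cons 17592187092992 (1) <| .cons 72339069014638592 (-1) <|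
    .cons 1208925819614697894182912 (-1) <| .cons 19342813113834066795298817 (-1) <|
    .cons 1267650600228229401496703205632 (1) <| .cons 21267668214968257618131336911736799232 (-1) <| .nil),
  (4112,
    .cons 1103806595072 (1) <| .cons 281475245146112 (-1) <| .cons 295147905179352826112 (1) <|
    .cons 79228162514264355185729994752 (1) <| .cons 20287361363808811945046847782912 (-1) <|
    .cons 324518553658426726783156020576257 (-1) <| .cons 83076749736557242056488009986998272 (-1) <| .nil),
  (268500992,
    .cons 4504699138998272 (-1) <| .cons 72057594037927952 (-1) <| .cons 1152921504606847232 (-1) <|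
    .cons 309485009821345137444257792 (1) <| .cons 79247505327378171660339249152 (-1) <|
    .cons 20282409608374036906816896499712 (1) <| .cons 324518553658426726783156021624832 (1) <| .nil),
  (1152921504606846977,
    .cons 295147905179353874432 (-1) <| .cons 1208925819614629443141632 (1) <|
    .cons 309485009821345068724785152 (1) <| .cons 1346878762742493739090247155712 (1) <|
    .cons 20282409603670117168020960837632 (-1) <| .cons 5192296858534827628531595840847872 (-1) <|
    .cons 83076749736557242128545535305449472 (-1) <| .nil),
  (18446744073709551872,
    .cons 4722366482869645213697 (-1) <| .cons 75557863727013835046912 (1) <|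
    .cons 1208925819614629174706192 (-1) <| .cons 309485009821626543701491712 (-1) <|
    .cons 4951760157141521099597545472 (1) <| .cons 83076749736557242056487941267587072 (1) <|
    .cons 21267648011786816480725250558029463552 (-1) <| .nil),
  (5017514388048998039552,
    .cons 75557863725914591854592 (-1) <| .cons 309485009821345073019748352 (1) <|
    .cons 4951760158294442604203343872 (-1) <| .cons 324518553658445173527229730127872 (-1) <|
    .cons 5192296858534827628530496329220112 (1) <| .cons 83076749736557242060991540894892032 (-1) <|
    .cons 1329228075013078387168144653824294912 (1) <| .nil),
  (75557935783508361347072,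
    .cons 1208925824118228802076672 (1) <| .cons 19342831560578140504850432 (1) <|
    .cons 309485009821345068741558272 (-1) <| .cons 1267650604950595884366348419072 (-1) <|
    .cons 5192296858534827628530496329285632 (-1) <| .cons 1329227995784915872903807060281393152 (-1) <|
    .cons 21267647932558653967613834469092360192 (1) <| .nil),
  (18446761665895596032,
    .cons 75557863725914323423232 (1) <| .cons 1208925819614633469673472 (1) <|
    .cons 1272602360385370922596299702272 (-1) <| .cons 5192296858534827628811971305930752 (-1) <|
    .cons 83076749736557242056487941284298752 (-1) <| .cons 1329227995784915872903807060280344577 (-1) <|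
    .cons 21267647932558654261608818143838339072 (1) <| .nil),
  (4722366500461831258113,
    .cons 75557863725914323423488 (1) <| .cons 75557863744606021091328 (-1) <|
    .cons 1208925819614633469673728 (1) <| .cons 1208925819632221360750608 (1) <|
    .cons 309485009821644135887536128 (1) <| .cons 4951760157141538691783589888 (-1) <|
    .cons 1272602360385370922596299702528 (-1) <| .cons 5192296858534827628811971305931008 (-1) <|
    .cons 83076749736557242056487941284299008 (-1) <| .cons 83076749736557242056505533453631488 (-1) <|
    .cons 1329227995784915872903807060280344833 (-1) <| .cons 21267647932558654261608818143838339328 (1) <|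
    .cons 21267648011786816480725268150215507968 (1) <| .nil),
  (4521191814463488,
    .cons 1152921504623624448 (-1) <| .cons 1152939096792956928 (-1) <|
    .cons 4722438558055869186048 (1) <| .cons 19342813118337666422669313 (-1) <|
    .cons 19342831560578209224327168 (1) <| .cons 19343108261739246148190208 (1) <|
    .cons 4971102970327412760429723648 (-1) <| .cons 79247505327378171660356026368 (-1) <|
    .cons 1267650600228233905096330576128 (1) <| .cons 1267650604950595884435067895808 (-1) <|
    .cons 20282409608374036906816913276928 (1) <| .cons 324518553658426726783156038402048 (1) <|
    .cons 325786204258654956184652723847168 (-1) <| .cons 1329227995784915872903807129000869888 (-1) <|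
    .cons 1329227995784915872975864654318272768 (-1) <| .cons 1329248278194519524574231007531696128 (1) <|
    .cons 21267647932558653967613834537811836928 (1) <| .cons 21267668214968257618135840511364169728 (-1) <|
    .cons 21267972451112312393259753714544017408 (1) <| .nil),
  (1152921508901814528,
    .cons 1152939096792891408 (1) <| .cons 295152408778980196608 (-1) <|
    .cons 4722366500462099693568 (-1) <| .cons 75557863725983311331328 (1) <|
    .cons 19343108261739246148124688 (-1) <| .cons 309485009821345141739225088 (-1) <|
    .cons 4971102970255355166660231168 (1) <| .cons 79228162514268858785357365248 (-1) <|
    .cons 79247505327378171664634216448 (1) <| .cons 20282409608374036906821191467008 (-1) <|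
    .cons 20287361363808816448646475153408 (1) <| .cons 324518553658427879986135604133888 (-1) <|
    .cons 324518553658445173527298449604608 (1) <| .cons 324518553658721874688335373467648 (1) <|
    .cons 324518553663149093266025665794048 (1) <| .cons 324518863143436548145816931401728 (1) <|
    .cons 324523505418583940361849655001088 (-1) <| .cons 324597781820940991120749581303808 (-1) <|
    .cons 344800963337636260933017595281408 (1) <| .cons 649037108525779273180941215858688 (1) <|
    .cons 5192296858534827628530565048696848 (-1) <| .cons 5516815412193254355313652349796608 (-1) <|
    .cons 83076749736557242060991609614368768 (1) <| .cons 83401268309558481897105164083396608 (-1) <|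
    .cons 1329227995784915872903807060548780288 (1) <| .cons 1329248278194519524574231007531630608 (-1) <|
    .cons 1329552514338574299630591315812548608 (-1) <| .nil),
  (17592455528448,
    .cons 1152921504606851328 (1) <| .cons 1152940196304519168 (-1) <|
    .cons 295219962773390754048 (-1) <| .cons 1208925819614698162618368 (-1) <|
    .cons 19342813113834067063734273 (-1) <| .cons 19343108261740345659752448 (1) <|
    .cons 309485009821345137444261888 (-1) <| .cons 79228162514336412779767922688 (-1) <|
    .cons 79247505327378171660339253248 (1) <| .cons 1267650600228229401496971641088 (1) <|
    .cons 20282409608374036906816896503808 (-1) <| .cons 20287361363808884002640885710848 (1) <|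
    .cons 324518553658426726783156021628928 (-1) <| .cons 324518553658426798840750058504193 (1) <|
    .cons 325786204258654956185752235409408 (-1) <| .cons 5192296858534827628531664560324608 (1) <|
    .cons 83076749736557242128545604024926208 (1) <| .cons 1329248278194519524574232107043258368 (1) <|
    .cons 21267668214968257618131336912005234688 (-1) <| .nil),
  (4521191813414913,
    .cons 295147905179369603328 (-1) <| .cons 295147922771538935808 (-1) <|
    .cons 19342813113834071090266113 (-1) <| .cons 19343108262020721124835328 (1) <|
    .cons 309485009821380253096869888 (-1) <| .cons 4951760157213596285820469248 (1) <|
    .cons 4971102970255355166391799808 (-1) <| .cons 1267650600228229401500998172928 (1) <|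
    .cons 1267650600228229419088889249808 (1) <| .cons 1272602360385370922665019179008 (-1) <|
    .cons 20282409679209534167453760749568 (-1) <| .cons 20287361363808811945046864560128 (1) <|
    .cons 324518553658426726783156037353473 (1) <| .cons 324518554867352546415377381326848 (-1) <|
    .cons 325786204258654956466127700492288 (-1) <| .cons 5192296858534827628548088515264768 (1) <|
    .cons 83076749755900055170339600248864768 (1) <| .cons 1329227995784915872903807060280348928 (-1) <|
    .cons 1329227995784915872903807128999821313 (-1) <| .cons 1329227995784915872903825751978016768 (1) <|
    .cons 1329248278194519524574512482508341248 (1) <| .cons 21267647932558653966460930556939993088 (-1) <|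
    .cons 21267647932558654261608818212557815808 (1) <| .cons 21267668214968257618131336916031766528 (-1) <|
    .cons 21267972451112312393187696120506093568 (1) <| .nil),
  (17592187093008,
    .cons 1153202979583557888 (1) <| .cons 295147905179352891648 (-1) <|
    .cons 4722366501561342885888 (-1) <| .cons 75557863727082554523648 (1) <|
    .cons 1208925819614697894182928 (-1) <| .cons 19342813113834066795298833 (-1) <|
    .cons 309485009821626612420968448 (-1) <| .cons 4971102970255356265903423488 (1) <|
    .cons 79228162514264355185730060288 (-1) <| .cons 79247505327378453135315959808 (1) <|
    .cons 1267650600228229401496703205648 (1) <| .cons 20282409608374037188291873210368 (-1) <|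
    .cons 20287361363808811945046847848448 (1) <| .cons 324518553658426726783156020641793 (1) <|
    .cons 324518553658426727064630998335488 (-1) <| .cons 83076749736557242056488009987063808 (1) <|
    .cons 1329227995784915872903808159791972608 (1) <| .cons 21267668214968257618131336911736799248 (-1) <|
    .cons 21267972451112312393187697220017717248 (-1) <| .nil),
  (75557863743506777899009,
    .cons 75853011631093676249344 (1) <| .cons 75853011649785373917184 (-1) <|
    .cons 1209220967519812822499584 (1) <| .cons 1209220967537400713576464 (1) <|
    .cons 309485009821362665205792769 (-1) <| .cons 309485304969549315240361984 (1) <|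
    .cons 4952969082961153321225682944 (-1) <| .cons 5261245166962883760507326464 (-1) <|
    .cons 1272602360680518827775652528384 (-1) <| .cons 1351830522899635277782029697024 (-1) <|
    .cons 20287361439366675670961171206144 (-1) <| .cons 20287362572734631559680317456384 (-1) <|
    .cons 21559963724194182867643147485184 (1) <| .cons 324518553733984590509070343999489 (-1) <|
    .cons 324518554867352546397789490249729 (-1) <| .cons 325791156018812097705752320278529 (1) <|
    .cons 5192296858534827628548088515264529 (-1) <| .cons 5192296858535122776717150658756864 (-1) <|
    .cons 5192301810294984770070287623389184 (1) <| .cons 5212584219898636440757018153713664 (1) <|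
    .cons 5516815412193254355595127326507009 (1) <| .cons 83076749755900055170322012357787649 (1) <|
    .cons 83076749755900350318508662392356864 (-1) <| .cons 83076750046042251877868194364391424 (1) <|
    .cons 83076754707660212311843107659321344 (1) <| .cons 83078017387157470285889442265694464 (-1) <|
    .cons 83078017387157470285907030156771344 (-1) <| .cons 83078022338917627427410606286700544 (1) <|
    .cons 83097032146236451590655395028271104 (1) <| .cons 83401268291424594602903318648848384 (1) <|
    .cons 83402535940815897012954068968013824 (1) <| .cons 88269046595092069685036029782786304 (-1) <|
    .cons 166153499492457297226827541516386304 (-1) <| .cons 1329227995784916168051712239633170689 (-1) <|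
    .cons 1329228075013078387168162246010339329 (-1) <| .cons 1329248283146279681715752107128127489 (1) <|
    .cons 1329552514338574299630590216300920834 (1) <| .cons 1412304745521473114960295001547870464 (1) <|
    .cons 1412304745521473114960295070267342849 (1) <| .cons 1412304745521473114960313693245538304 (-1) <|
    .cons 1412325027931076766631000423775862784 (-1) <| .cons 21267647932558654556756723323191165184 (1) <|
    .cons 21267648011786816775873173329568333824 (1) <| .cons 21267668219920018070420763190686121984 (-1) <|
    .cons 21267972451112312688335601299858915329 (-1) <| .cons 21350724682295211208517418498207514624 (1) <|
    .cons 21350724682295211503665306153825337344 (-1) <| .cons 21350744964704814860187824857299288064 (1) <|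
    .cons 21351049200848869635244184061773615104 (-1) <| .nil)]

/-- The critical pairs. -/
def crit : List (List ℕ) :=
  [[], [0], [1,0], [0,1,2], [1,3,0], [2,3,0], [0,1,2,3,4,5],
    [0,1,2,3,4,5,6], [0,1,2,3,4,5,6,7], [0,1,2,3,4,5,6,7,8], [7,0,1,2,3,4,5,6,8,9],
    [6,8,10,0,1,2,3,4,5,9], [0,10,1,2,3,4,5,6,8,9,11], [0,6,7,1,2,3,4,5,8,9],
    [0,2,5,10,12,4,6,8,9,11], [6,10,11,12,1,2,3,4,5,9], [0,1,4,10,12,14,6,8,9,11],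
    [2,5,6,9,10,11,14,15,4]]
/-- Element of the Groebner basis. -/
def gbe (j : ℕ) : ℕ × PL := GB.getD j (0, .nil)

/-- Boolean test of all codes of a term list. -/
def PL.allB (P : ℕ → Bool) : PL → Bool :=
  PL.rec (motive := fun _ => Bool) true (fun m _ _ ih => P m && ih)

theorem PL.allB_spec {P : ℕ → Bool} {p : PL} (h : p.allB P = true) : p.All fun m => P m = true := by
  induction p with
  | nil => trivial
  | cons m c t ih =>
    have h' : (P m && t.allB P) = true := h
    rw [Bool.and_eq_true] at h'
    exact ⟨h'.1, ih h'.2⟩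

/-- Boolean version of `okc`. -/
def okb (c : ℕ) : Bool := Nat.beq (Nat.land c msk) 0

theorem okb_spec {c : ℕ} (h : okb c = true) : okc c := Nat.eq_of_beq_eq_true h

/-- Static test of an element of the Groebner basis. -/
def chkS (g : ℕ × PL) : Bool :=
  okb g.1 && g.2.allB fun m => okb m && (Nat.blt (wtc m) (wtc g.1) && Nat.beq (dgc m) (dgc g.1))

theorem GB_chkS : GB.all chkS = true := by decide +kernel

theorem GB_static {g : ℕ × PL} (hg : g ∈ GB) :
    okc g.1 ∧ g.2.All fun m => okc m ∧ wt (dec m) < wt (dec g.1) ∧ dg (dec m) = dg (dec g.1) := by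
  have h := List.all_eq_true.1 GB_chkS g hg
  rw [chkS, Bool.and_eq_true] at h
  refine ⟨okb_spec h.1, (PL.allB_spec h.2).mono fun m hm => ?_⟩
  rw [Bool.and_eq_true, Bool.and_eq_true] at hm
  rw [wt_dec, wt_dec, dg_dec, dg_dec]
  refine ⟨okb_spec hm.1, ?_, Nat.eq_of_beq_eq_true hm.2.2⟩
  have := hm.2.1
  rwa [Nat.blt_eq] at this

/-- The cofactor of the second lead in the least common multiple (for square-free leads). -/
def cof (a b : ℕ) : ℕ := Nat.lor a b - b

/-- Test of a critical pair with given cofactors. -/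
def chkP' (gi gj : ℕ × PL) (q r : ℕ) : Bool :=
  okb q && (okb r && (Nat.beq (q + gj.1) (r + gi.1) &&
    red GB 300 (PL.add (PL.smul q 1 gj.2) (PL.smul r (-1) gi.2))))

/-- Test of a critical pair. -/
def chkP (j i : ℕ) : Bool :=
  chkP' (gbe i) (gbe j) (cof (gbe i).1 (gbe j).1) (cof (gbe j).1 (gbe i).1)

/-- Test of all critical pairs with given second element. -/
def chkJ (j : ℕ) : Bool := (crit.getD j []).all (chkP j)

/-- Test of covering. -/
def chkC (j i : ℕ) : Bool :=
  (crit.getD j []).any fun i' => Nat.blt i' j && (List.range 32).all fun p =>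
    Nat.ble (dig (cof (gbe i').1 (gbe j).1) p) (dig (gbe i).1 p - dig (gbe j).1 p)

theorem GB_chkC : ((List.range 18).all fun j => (List.range j).all (chkC j)) = true := by
  decide +kernel

theorem GB_chkJ_0 : chkJ 0 = true := by decide +kernel
theorem GB_chkJ_1 : chkJ 1 = true := by decide +kernel
theorem GB_chkJ_2 : chkJ 2 = true := by decide +kernel
theorem GB_chkJ_3 : chkJ 3 = true := by decide +kernel
theorem GB_chkJ_4 : chkJ 4 = true := by decide +kernel
theorem GB_chkJ_5 : chkJ 5 = true := by decide +kernel
theorem GB_chkJ_6 : chkJ 6 = true := by decide +kernel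
theorem GB_chkJ_7 : chkJ 7 = true := by decide +kernel
theorem GB_chkJ_8 : chkJ 8 = true := by decide +kernel
theorem GB_chkJ_9 : chkJ 9 = true := by decide +kernel
theorem GB_chkJ_10 : chkJ 10 = true := by decide +kernel
theorem GB_chkJ_11 : chkJ 11 = true := by decide +kernel
theorem GB_chkJ_12 : chkJ 12 = true := by decide +kernel
theorem GB_chkJ_13 : chkJ 13 = true := by decide +kernel
theorem GB_chkJ_14 : chkJ 14 = true := by decide +kernel
theorem GB_chkJ_15 : chkJ 15 = true := by decide +kernel
theorem GB_chkJ_16 : chkJ 16 = true := by decide +kernel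
theorem GB_chkJ_17 : chkJ 17 = true := by decide +kernel

theorem GB_chkJ (j : ℕ) (hj : j < 18) : chkJ j = true := by
  interval_cases j
  · exact GB_chkJ_0
  · exact GB_chkJ_1
  · exact GB_chkJ_2
  · exact GB_chkJ_3
  · exact GB_chkJ_4
  · exact GB_chkJ_5
  · exact GB_chkJ_6
  · exact GB_chkJ_7
  · exact GB_chkJ_8
  · exact GB_chkJ_9
  · exact GB_chkJ_10
  · exact GB_chkJ_11
  · exact GB_chkJ_12
  · exact GB_chkJ_13
  · exact GB_chkJ_14
  · exact GB_chkJ_15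
  · exact GB_chkJ_16
  · exact GB_chkJ_17

section gbfacts

open MvPolynomial

theorem gbe_mem (j : ℕ) (hj : j < 18) : gbe j ∈ GB := by
  have hl : j < GB.length := hj
  rw [gbe, List.getD_eq_getElem _ _ hl]
  exact List.getElem_mem hl

theorem mem_GB {g : ℕ × PL} (hg : g ∈ GB) : ∃ j : Fin 18, gbe j = g := by
  obtain ⟨j, hj, rfl⟩ := List.getElem_of_mem hg
  exact ⟨⟨j, hj⟩, List.getD_eq_getElem _ _ hj⟩

/-- Leading exponents. -/
def gl (j : Fin 18) : Mon := dec (gbe j).1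

/-- Tails. -/
def gt (j : Fin 18) : R32 := ev (gbe j).2

theorem gt_support (j : Fin 18) : ∀ u ∈ (gt j).support, wt u < wt (gl j) ∧ dg u = dg (gl j) := by
  have h := (GB_static (gbe_mem j j.isLt)).2
  exact ev_support (P := fun u => wt u < wt (gl j) ∧ dg u = dg (gl j)) (h.mono fun m hm => hm.2)

theorem GB_ok : ∀ g ∈ GB, okc g.1 ∧ g.2.All okc := fun _ hg =>
  ⟨(GB_static hg).1, (GB_static hg).2.mono fun _ hm => hm.1⟩

theorem ev_spair {a b : PL} (ha : a.All okc) (hb : b.All okc) {q r : ℕ} (hq : okc q) (hr : okc r) :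
    ev (PL.add (PL.smul q 1 a) (PL.smul r (-1) b)) =
      monomial (dec q) 1 * ev a - monomial (dec r) 1 * ev b := by
  rw [ev_add, ev_smul hq _ ha, ev_smul hr _ hb]
  have : (monomial (dec r) ((-1 : ℤ) : ℂ) : R32) = - monomial (dec r) 1 := by
    rw [← map_neg]; simp
  rw [this]
  simp [sub_eq_add_neg]

theorem GB_reduces (j i : Fin 18) (h : chkP j i = true) :
    ∃ r : Mon, dec (cof (gbe i).1 (gbe j).1) + gl j = r + gl i ∧
      Reduces gl gt (monomial (dec (cof (gbe i).1 (gbe j).1)) 1 * gt j - monomial r 1 * gt i)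
        (wt (dec (cof (gbe i).1 (gbe j).1) + gl j)) := by
  rw [chkP, chkP'] at h
  simp only [Bool.and_eq_true] at h
  obtain ⟨hq, hr, hqr, hred⟩ := h
  generalize cof (gbe i).1 (gbe j).1 = q at *
  generalize cof (gbe j).1 (gbe i).1 = r at *
  replace hq := okb_spec hq
  replace hr := okb_spec hr
  replace hqr := Nat.eq_of_beq_eq_true hqr
  have hj := GB_static (gbe_mem j j.isLt)
  have hi := GB_static (gbe_mem i i.isLt)
  have hj' := GB_ok _ (gbe_mem j j.isLt)
  have hi' := GB_ok _ (gbe_mem i i.isLt)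
  have hdec : dec q + gl j = dec r + gl i := by
    rw [gl, gl, ← dec_add hq hj.1, ← dec_add hr hi.1, hqr]
  refine ⟨dec r, hdec, ?_⟩
  intro N' m' hN'
  rw [gt, gt, ← ev_spair hj'.2 hi'.2 hq hr]
  refine red_sound GB_ok N' m' (fun u => wt u < wt (dec q + gl j)) ?_ ?_ 300 _ ?_ hred
  · intro g hg u hu
    obtain ⟨k, rfl⟩ := mem_GB hg
    exact hN' u k hu
  · intro g hg u hu
    refine (GB_static hg).2.mono fun m hm => ?_
    have := hm.2.1
    simp only [wt_add] at hu ⊢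
    omega
  · refine all_add (all_smul _ (hj.2.mono fun m hm => ?_)) (all_smul _ (hi.2.mono fun m hm => ?_))
    · have := hm.2.1
      rw [dec_add hm.1 hq]
      simp only [wt_add, gl]
      omega
    · have := hm.2.1
      rw [dec_add hm.1 hr, hdec]
      simp only [wt_add, gl]
      omega

theorem GB_buch : ∀ i j : Fin 18, i < j → ∀ m, gl i ≤ m + gl j → ∃ i' < j, ∃ q' r, q' ≤ m ∧
      q' + gl j = r + gl i' ∧
      Reduces gl gt (monomial q' 1 * gt j - monomial r 1 * gt i') (wt (q' + gl j)) := by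
  intro i j hij m hm
  have h1 := List.all_eq_true.1 GB_chkC j (List.mem_range.2 j.isLt)
  have h2 := List.all_eq_true.1 h1 i (List.mem_range.2 hij)
  rw [chkC, List.any_eq_true] at h2
  obtain ⟨i', hi'm, h3⟩ := h2
  rw [Bool.and_eq_true, Nat.blt_eq] at h3
  have h4 := List.all_eq_true.1 (GB_chkJ j j.isLt) i' hi'm
  have hlt : i' < 18 := h3.1.trans j.isLt
  obtain ⟨r, hr, hred⟩ := GB_reduces j ⟨i', hlt⟩ h4
  refine ⟨⟨i', hlt⟩, h3.1, _, r, ?_, hr, hred⟩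
  intro S
  have h5 := List.all_eq_true.1 h3.2 (pe S) (List.mem_range.2 (pe S).isLt)
  replace h5 := Nat.le_of_ble_eq_true h5
  have h6 := hm S
  rw [Finsupp.add_apply, gl, gl, dec_apply, dec_apply] at h6
  rw [dec_apply]
  change dig (cof (gbe i').1 (gbe j).1) _ ≤ _
  omega

end gbfacts

/-! ### The cubic and quartic elements of the Groebner basis lie in the ideal -/

section members

open MvPolynomial

/-- Test of an S-polynomial which reduces to a multiple of the element with index `k`. -/
def chkM (k a b : ℕ) (s : ℤ) (q r : ℕ) : Bool :=
  okb q && (okb r && (Nat.beq (q + (gbe a).1) (r + (gbe b).1) && (Nat.blt a k && (Nat.blt b k &&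
    (Nat.blt k 18 && ((s * s == 1) &&
    red (GB.take k) 300 (PL.add (PL.smul 0 (-s) (.cons (gbe k).1 1 (gbe k).2))
      (PL.add (PL.smul q 1 (gbe a).2) (PL.smul r (-1) (gbe b).2)))))))))

theorem mem_of_chkM {k a b : ℕ} {s : ℤ} {q r : ℕ} (h : chkM k a b s q r = true) (I : Ideal R32)
    (hI : ∀ j < k, gpoly (gbe j) ∈ I) : gpoly (gbe k) ∈ I := by
  rw [chkM] at h
  simp only [Bool.and_eq_true, Nat.blt_eq, beq_iff_eq] at h
  obtain ⟨hq, hr, hqr, ha, hb, hk, hs, hred⟩ := h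
  replace hq := okb_spec hq
  replace hr := okb_spec hr
  replace hqr := Nat.eq_of_beq_eq_true hqr
  have hga := GB_ok _ (gbe_mem a (ha.trans hk))
  have hgb := GB_ok _ (gbe_mem b (hb.trans hk))
  have hgk := GB_ok _ (gbe_mem k hk)
  have h0 : okc 0 := by unfold okc; exact Nat.zero_and _
  have hd0 : dec 0 = 0 := by ext S; simp [dec_apply, dig]
  have key := red_sound (G := GB.take k) (fun g hg => GB_ok g (List.mem_of_mem_take hg))
    (I.restrictScalars ℂ) 0 (fun _ => True)
    (fun g hg u _ => by
      obtain ⟨j, hj, rfl⟩ := List.getElem_of_mem hg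
      rw [List.getElem_take]
      have hj' : j < k := by
        rw [List.length_take] at hj; omega
      have := hI j hj'
      rw [gbe, List.getD_eq_getElem _ _ (by rw [List.length_take] at hj; omega)] at this
      exact I.mul_mem_left _ this)
    (fun g hg u _ => (GB_ok g (List.mem_of_mem_take hg)).2.mono fun _ _ => trivial)
    300 _ (all_add (all_smul _ ((show (PL.cons (gbe k).1 1 (gbe k).2).All okc from hgk).mono
      fun _ _ => trivial)) (all_add (all_smul _ (hga.2.mono fun _ _ => trivial))
        (all_smul _ (hgb.2.mono fun _ _ => trivial)))) hred
  rw [ev_add, ev_spair hga.2 hgb.2 hq hr,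
    ev_smul h0 _ (show (PL.cons (gbe k).1 1 (gbe k).2).All okc from hgk), hd0] at key
  have hm0 : (monomial (0 : Mon) (1 : ℂ) : R32) = 1 := rfl
  rw [hm0, one_mul, Submodule.restrictScalars_mem] at key
  have e1 : (monomial (dec q) (1 : ℂ) * monomial (dec (gbe a).1) 1 : R32) =
      monomial (dec r) 1 * monomial (dec (gbe b).1) 1 := by
    rw [monomial_mul, monomial_mul, ← dec_add hq hga.1, ← dec_add hr hgb.1, hqr]
  have e2 : (monomial (0 : Mon) ((-s : ℤ) : ℂ) : R32) = - C (s : ℂ) := by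
    rw [← map_neg]; push_cast; rfl
  have e3 : (C (s : ℂ) : R32) * C (s : ℂ) = 1 := by
    rw [← C_mul]
    have : (s : ℂ) * s = 1 := by exact_mod_cast hs
    rw [this, C_1]
  have hA := I.mul_mem_left (monomial (dec q) 1) (hI a ha)
  have hB := I.mul_mem_left (monomial (dec r) 1) (hI b hb)
  have h3 := I.mul_mem_left (C (s : ℂ)) (I.sub_mem (I.sub_mem hA hB) key)
  convert h3 using 1
  rw [e2]
  simp only [gpoly, ev, Int.cast_one]
  linear_combination (- (monomial (dec (gbe k).1) (1 : ℂ) + ev (gbe k).2)) * e3 - C (s : ℂ) * e1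

theorem GB_mem_of (I : Ideal R32) (hI : ∀ j < 11, gpoly (gbe j) ∈ I) :
    ∀ j < 18, gpoly (gbe j) ∈ I := by
  have step : ∀ k : ℕ, (∀ j < k, gpoly (gbe j) ∈ I) → gpoly (gbe k) ∈ I →
      ∀ j < k + 1, gpoly (gbe j) ∈ I := by
    intro k h1 h2 j hj
    rcases Nat.lt_succ_iff_lt_or_eq.1 hj with h | h
    · exact h1 j h
    · exact h ▸ h2
  have h12 := step 11 hI (mem_of_chkM (a := 7) (b := 10) (s := -1)
    (q := cof (gbe 10).1 (gbe 7).1) (r := cof (gbe 7).1 (gbe 10).1) (by decide +kernel) I hI)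
  have h13 := step 12 h12 (mem_of_chkM (a := 2) (b := 5) (s := -1)
    (q := cof (gbe 5).1 (gbe 2).1) (r := cof (gbe 2).1 (gbe 5).1) (by decide +kernel) I h12)
  have h14 := step 13 h13 (mem_of_chkM (a := 1) (b := 2) (s := -1)
    (q := cof (gbe 2).1 (gbe 1).1) (r := cof (gbe 1).1 (gbe 2).1) (by decide +kernel) I h13)
  have h15 := step 14 h14 (mem_of_chkM (a := 3) (b := 5) (s := 1)
    (q := cof (gbe 5).1 (gbe 3).1) (r := cof (gbe 3).1 (gbe 5).1) (by decide +kernel) I h14)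
  have h16 := step 15 h15 (mem_of_chkM (a := 1) (b := 4) (s := 1)
    (q := cof (gbe 4).1 (gbe 1).1) (r := cof (gbe 1).1 (gbe 4).1) (by decide +kernel) I h15)
  have h17 := step 16 h16 (mem_of_chkM (a := 3) (b := 4) (s := 1)
    (q := cof (gbe 4).1 (gbe 3).1) (r := cof (gbe 3).1 (gbe 4).1) (by decide +kernel) I h16)
  have h18 := step 17 h17 (mem_of_chkM (a := 8) (b := 11) (s := -1)
    (q := cof (gbe 11).1 (gbe 8).1) (r := cof (gbe 8).1 (gbe 11).1) (by decide +kernel) I h17)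
  exact h18

theorem span_GB : Ideal.span (Set.range fun j : Fin 18 => (monomial (gl j) 1 + gt j : R32)) =
    Ideal.span (Set.range fun j : Fin 11 => gpoly (gbe j)) := by
  apply le_antisymm
  · rw [Ideal.span_le]
    rintro _ ⟨j, rfl⟩
    exact GB_mem_of (Ideal.span (Set.range fun j : Fin 11 => gpoly (gbe j)))
      (fun i hi => Ideal.subset_span (Set.mem_range.2 ⟨(⟨i, hi⟩ : Fin 11), rfl⟩)) j j.isLt
  · rw [Ideal.span_le]
    rintro _ ⟨j, rfl⟩
    exact Ideal.subset_span (Set.mem_range.2 ⟨(⟨j, by omega⟩ : Fin 18), rfl⟩)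

end members

/-! ### Counting the standard monomials -/

section counting

/-- A monomial survives if it is divisible by none of the square-free monomials in the list. -/
def surv (L : List (List (Fin 32))) (m : Mon) : Prop := ∀ l ∈ L, ∃ p ∈ l, m (pe.symm p) = 0

open Classical in
/-- The number of surviving monomials of a given degree. -/
def cnt (L : List (List (Fin 32))) (n : ℕ) : ℕ :=
  ((Finset.univ.finsuppAntidiag n).filter (surv L)).card

open Classical in
/-- The number of surviving monomials without a given variable. -/
def cnt0 (x : Fin 32) (L : List (List (Fin 32))) (n : ℕ) : ℕ :=
  ((Finset.univ.finsuppAntidiag n).filter fun m => surv L m ∧ m (pe.symm x) = 0).card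

/-- The generators not involving a variable. -/
def gkeep (x : Fin 32) (L : List (List (Fin 32))) : List (List (Fin 32)) :=
  L.filter fun l => l.all fun y => !(Nat.beq y x)

/-- Delete a variable. -/
def gdel (x : Fin 32) (L : List (List (Fin 32))) : List (List (Fin 32)) :=
  L.map fun l => l.filter fun y => !(Nat.beq y x)

theorem beq_fin {x y : Fin 32} : (!(Nat.beq y x)) = true ↔ y ≠ x := by
  rw [Bool.not_eq_true', ← Bool.not_eq_true, Nat.beq_eq, Fin.val_inj]

theorem surv_gdel (x : Fin 32) (L : List (List (Fin 32))) (m : Mon) :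
    surv L (m + Finsupp.single (pe.symm x) 1) ↔ surv (gdel x L) m := by
  simp only [surv, gdel, List.mem_map, forall_exists_index, and_imp, forall_apply_eq_imp_iff₂]
  refine forall₂_congr fun l _ => exists_congr fun p => ?_
  rw [List.mem_filter, beq_fin, Finsupp.add_apply]
  by_cases hp : p = x
  · subst hp; simp
  · rw [Finsupp.single_eq_of_ne (by simpa using hp)]
    simp [hp]

theorem surv_gkeep (x : Fin 32) (L : List (List (Fin 32))) (m : Mon) (h : m (pe.symm x) = 0) :
    surv L m ↔ surv (gkeep x L) m := by
  simp only [surv, gkeep, List.mem_filter, and_imp]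
  refine forall₂_congr fun l _ => ⟨fun h1 _ => h1, fun h1 => ?_⟩
  by_cases hx : x ∈ l
  · exact ⟨x, hx, h⟩
  · refine h1 (List.all_eq_true.2 fun y hy => ?_)
    rw [beq_fin]
    rintro rfl
    exact hx hy

theorem gdel_gkeep (x : Fin 32) (L : List (List (Fin 32))) : gdel x (gkeep x L) = gkeep x L := by
  rw [gdel, gkeep]
  conv_rhs => rw [← List.map_id (L.filter _)]
  refine List.map_congr_left fun l hl => ?_
  rw [List.mem_filter, List.all_eq_true] at hl
  exact List.filter_eq_self.2 hl.2

theorem cnt0_gkeep (x : Fin 32) (L : List (List (Fin 32))) (n : ℕ) :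
    cnt0 x L n = cnt0 x (gkeep x L) n := by
  classical
  unfold cnt0
  congr 1
  refine Finset.filter_congr fun m _ => ?_
  refine and_congr_left fun h => surv_gkeep x L m h

theorem cnt_zero (x : Fin 32) (L : List (List (Fin 32))) : cnt L 0 = cnt0 x L 0 := by
  classical
  unfold cnt cnt0
  refine congrArg Finset.card (Finset.filter_congr fun m hm => ?_)
  simp only [Finset.finsuppAntidiag_zero, Finset.mem_singleton] at hm
  simp [hm]

theorem cnt_succ (x : Fin 32) (L : List (List (Fin 32))) (n : ℕ) :
    cnt L (n + 1) = cnt0 x L (n + 1) + cnt (gdel x L) n := by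
  classical
  unfold cnt cnt0
  rw [← Finset.card_filter_add_card_filter_not (s := (Finset.univ.finsuppAntidiag (n + 1)).filter (surv L))
    (fun m => m (pe.symm x) = 0), Finset.filter_filter, Finset.filter_filter]
  congr 1
  symm
  refine Finset.card_bij (fun m _ => m + Finsupp.single (pe.symm x) 1) ?_ ?_ ?_
  · intro m hm
    simp only [Finset.mem_filter, Finset.mem_finsuppAntidiag, Finset.subset_univ, and_true] at hm ⊢
    refine ⟨?_, (surv_gdel x L m).2 hm.2, by simp⟩
    rw [← hm.1]
    simp [Finset.sum_add_distrib, Finsupp.single_apply]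
  · intro a _ b _ h
    exact add_right_cancel h
  · intro m hm
    simp only [Finset.mem_filter, Finset.mem_finsuppAntidiag, Finset.subset_univ, and_true] at hm
    obtain ⟨h1, h2, h3⟩ := hm
    have hle : Finsupp.single (pe.symm x) 1 ≤ m := by
      rw [Finsupp.single_le_iff]; omega
    obtain ⟨m', rfl⟩ := exists_add_of_le hle
    rw [add_comm] at h1 h2 ⊢
    refine ⟨m', ?_, rfl⟩
    simp only [Finset.mem_filter, Finset.mem_finsuppAntidiag, Finset.subset_univ, and_true]
    refine ⟨?_, (surv_gdel x L m').1 h2⟩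
    simp [Finset.sum_add_distrib, Finsupp.single_apply] at h1
    exact h1

open PowerSeries

/-- The Hilbert series. -/
def HS (L : List (List (Fin 32))) : PowerSeries ℤ := PowerSeries.mk fun n => (cnt L n : ℤ)

theorem HS_rec (x : Fin 32) (L : List (List (Fin 32))) :
    HS L = HS (gkeep x L) + X * (HS (gdel x L) - HS (gkeep x L)) := by
  ext n
  cases n with
  | zero =>
    simp only [HS, map_add, coeff_zero_X_mul, coeff_mk, add_zero]
    rw [cnt_zero x L, cnt_zero x (gkeep x L), cnt0_gkeep]
  | succ n =>
    simp only [HS, map_add, map_sub, coeff_succ_X_mul, coeff_mk]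
    rw [cnt_succ x L, cnt_succ x (gkeep x L), cnt0_gkeep, gdel_gkeep]
    push_cast
    ring

theorem HS_nil : HS [] * (1 - X) ^ 32 = 1 := by
  have h : HS [] = PowerSeries.mk fun n => ((31 + n).choose 31 : ℤ) := by
    ext n
    simp only [HS, coeff_mk]
    classical
    refine congrArg Nat.cast ?_
    unfold cnt
    rw [Finset.filter_true_of_mem (fun m _ => by simp [surv]),
      Finset.card_finsuppAntidiag_nat_eq_choose]
    simp only [Finset.card_univ, Fintype.card_finset, Fintype.card_fin]
    rw [show 2 ^ 5 + n - 1 = 31 + n by omega, Nat.choose_symm_add]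
  rw [h]
  exact mk_add_choose_mul_one_sub_pow_eq_one ℤ 31

theorem HS_of_nil_mem {L : List (List (Fin 32))} (h : [] ∈ L) : HS L = 0 := by
  ext n
  simp only [HS, coeff_mk, map_zero, Nat.cast_eq_zero]
  classical
  unfold cnt
  rw [Finset.card_eq_zero, Finset.filter_eq_empty_iff]
  intro m _ hs
  obtain ⟨p, hp, _⟩ := hs [] h
  simp at hp

/-- Power series from coefficient lists. -/
def evL : List ℤ → PowerSeries ℤ
  | [] => 0
  | a :: l => C a + X * evL l

/-- Sum of two coefficient lists. -/
def laddL (p : List ℤ) : List ℤ → List ℤ :=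
  List.rec (motive := fun _ => List ℤ → List ℤ) (fun q => q)
    (fun a p' ih q => List.rec (motive := fun _ => List ℤ) (a :: p')
      (fun b q' _ => (a + b) :: ih q') q) p

/-- Negation of a coefficient list. -/
def lnegL (p : List ℤ) : List ℤ :=
  List.rec (motive := fun _ => List ℤ) [] (fun a _ ih => (-a) :: ih) p

theorem evL_add (p q : List ℤ) : evL (laddL p q) = evL p + evL q := by
  induction p generalizing q with
  | nil => simp [laddL, evL]
  | cons a p ih =>
    cases q with
    | nil => simp [laddL, evL]
    | cons b q =>
      have h : laddL (a :: p) (b :: q) = (a + b) :: laddL p q := rfl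
      rw [h, evL, evL, evL, ih, map_add]
      ring

theorem evL_neg (p : List ℤ) : evL (lnegL p) = - evL p := by
  induction p with
  | nil => simp [lnegL, evL]
  | cons a p ih =>
    have h : lnegL (a :: p) = (-a) :: lnegL p := rfl
    rw [h, evL, evL, ih, map_neg]
    ring

/-- The numerator of the Hilbert series. -/
def Knum : ℕ → List (List (Fin 32)) → Option (List ℤ)
  | 0, _ => none
  | _ + 1, [] => some [1]
  | _ + 1, [] :: _ => some []
  | n + 1, (x :: l) :: L =>
    bif L.any List.isEmpty then some [] else
    (Knum n (gkeep x ((x :: l) :: L))).bind fun a =>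
      (Knum n (gdel x ((x :: l) :: L))).bind fun b =>
        some (laddL a (0 :: laddL b (lnegL a)))

theorem Knum_sound (n : ℕ) (L : List (List (Fin 32))) (k : List ℤ) (h : Knum n L = some k) :
    HS L * (1 - X) ^ 32 = evL k := by
  induction n generalizing L k with
  | zero => simp [Knum] at h
  | succ n ih =>
    match L, h with
    | [], h =>
      simp only [Knum, Option.some.injEq] at h
      rw [HS_nil, ← h]; simp [evL]
    | [] :: L, h =>
      simp only [Knum, Option.some.injEq] at h
      rw [HS_of_nil_mem (by simp), ← h]; simp [evL]
    | (x :: l) :: L, h =>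
      rw [Knum] at h
      cases he : L.any List.isEmpty with
      | true =>
        rw [he] at h
        simp only [cond_true, Option.some.injEq] at h
        rw [List.any_eq_true] at he
        obtain ⟨l', hl', he⟩ := he
        have : l' = [] := List.isEmpty_iff.1 he
        subst this
        rw [HS_of_nil_mem (by simp [hl']), ← h]; simp [evL]
      | false =>
        rw [he] at h
        simp only [cond_false, Option.bind_eq_some_iff, Option.some.injEq] at h
        obtain ⟨a, ha, b, hb, rfl⟩ := h
        rw [HS_rec x, evL_add, evL, evL_add, evL_neg, ← ih _ _ ha, ← ih _ _ hb]
        simp only [map_zero]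
        ring

/-- The leading monomials, in a convenient order. -/
def leads : List (List (Fin 32)) :=
  [[1,6],[0,11,13],[16,2],[18,0,11],[16,11],[7,4],[7,5,11],[6,7],[3,4],[0,15],[19,7,0,11],
    [1,5,11],[14,19],[1,3],[8,2,15],[5,8],[5,11,13],[18,17]]

theorem Knum_leads : Knum 60 leads =
    some [1, 0, -11, 0, 66, -32, -231, 352, 0, -352, 231, 32, -66, 0, 11, 0, -1] := by
  decide +kernel

theorem HS_leads : HS leads = evL [1, 9, 34, 66, 66, 34, 9, 1] *
    PowerSeries.mk fun n => ((22 + n).choose 22 : ℤ) := by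
  have h := Knum_sound _ _ _ Knum_leads
  have h2 := mk_add_choose_mul_one_sub_pow_eq_one ℤ 22
  have hX : (1 - X : PowerSeries ℤ) ≠ 0 := by
    intro h0
    have := congrArg (PowerSeries.coeff 0) h0
    simp at this
  have h3 : evL [1, 0, -11, 0, 66, -32, -231, 352, 0, -352, 231, 32, -66, 0, 11, 0, -1] =
      evL [1, 9, 34, 66, 66, 34, 9, 1] * (1 - X) ^ 9 := by
    simp only [evL, map_one, map_zero, map_neg, map_ofNat]
    ring
  rw [h3] at h
  have h4 : HS leads * (1 - X) ^ 23 = evL [1, 9, 34, 66, 66, 34, 9, 1] :=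
    mul_right_cancel₀ (pow_ne_zero 9 hX) (by rw [← h]; ring)
  rw [← h4, mul_assoc, mul_comm ((1 - X : PowerSeries ℤ) ^ 23), h2, mul_one]

theorem coeff_evL_mul (l : List ℤ) (f : ℕ → ℤ) (hf : ∀ n, f n = ((22 + n).choose 22 : ℤ))
    (d n : ℕ) (hd : d + l.length ≤ 22) :
    PowerSeries.coeff n (X ^ d * (evL l * PowerSeries.mk f)) =
      ((l.zipIdx d).map fun x => x.1 * ((22 + n - x.2).choose 22 : ℤ)).sum := by
  induction l generalizing d with
  | nil => simp [evL]
  | cons a l ih =>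
    have e : X ^ d * (evL (a :: l) * PowerSeries.mk f) =
        C a * (X ^ d * PowerSeries.mk f) + X ^ (d + 1) * (evL l * PowerSeries.mk f) := by
      rw [evL]; ring
    simp only [List.length_cons] at hd
    rw [e, map_add, ih (d + 1) (by omega), List.zipIdx_cons, List.map_cons, List.sum_cons,
      PowerSeries.coeff_C_mul, PowerSeries.coeff_X_pow_mul']
    congr 2
    split_ifs with hdn
    · rw [coeff_mk, hf]
      congr 3
      omega
    · rw [Nat.choose_eq_zero_of_lt (by omega)]; simp

theorem cnt_leads (n : ℕ) : (cnt leads n : ℤ) =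
    ((22 + n).choose 22 : ℤ) + 9 * ((21 + n).choose 22 : ℤ) + 34 * ((20 + n).choose 22 : ℤ) +
    66 * ((19 + n).choose 22 : ℤ) + 66 * ((18 + n).choose 22 : ℤ) + 34 * ((17 + n).choose 22 : ℤ) +
    9 * ((16 + n).choose 22 : ℤ) + ((15 + n).choose 22 : ℤ) := by
  have h := congrArg (PowerSeries.coeff n) HS_leads
  rw [HS, coeff_mk] at h
  have h2 := coeff_evL_mul [1, 9, 34, 66, 66, 34, 9, 1] (fun n => ((22 + n).choose 22 : ℤ))
    (fun _ => rfl) 0 n (by simp)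
  rw [pow_zero, one_mul] at h2
  rw [h, h2]
  have e : ∀ i ≤ 22, 22 + n - i = 22 - i + n := fun i hi => by omega
  simp only [List.zipIdx_cons, List.zipIdx_nil, List.map_cons, List.map_nil, List.sum_cons,
    List.sum_nil, zero_add, Nat.reduceAdd]
  rw [e 0 (by norm_num), e 1 (by norm_num), e 2 (by norm_num), e 3 (by norm_num), e 4 (by norm_num),
    e 5 (by norm_num), e 6 (by norm_num), e 7 (by norm_num)]
  norm_num
  ring

theorem choose_prod (n i : ℕ) : ((i + n).choose 22 : ℤ) * (Nat.factorial 22 : ℤ) =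
    ∏ k ∈ Finset.range 22, ((i + n : ℤ) - k) := by
  have h := Nat.descFactorial_eq_factorial_mul_choose (i + n) 22
  rw [mul_comm]
  have h2 : ((Nat.factorial 22 : ℤ)) * ((i + n).choose 22 : ℤ) = ((i + n).descFactorial 22 : ℤ) := by
    rw [h]; push_cast; ring
  rw [h2, ← descPochhammer_eval_eq_descFactorial, descPochhammer_eval_eq_prod_range]
  push_cast
  rfl

theorem cnt_formula (n : ℕ) : cnt leads n * (5 * 2 * 3 * 7 * Nat.factorial 19) =
        (5 * n ^ 4 + 160 * n ^ 3 + 2107 * n ^ 2 + 13232 * n + 38760) *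
          ((n + 7) * (n + 8) * (n + 9)) * ∏ i ∈ Finset.Icc 1 15, (n + i) := by
  have h := cnt_leads n
  have key : ((cnt leads n : ℤ)) * (Nat.factorial 22 : ℤ) = 44 *
      ((5 * n ^ 4 + 160 * n ^ 3 + 2107 * n ^ 2 + 13232 * n + 38760) *
          ((n + 7) * (n + 8) * (n + 9)) * ∏ i ∈ Finset.Icc (1 : ℕ) 15, ((n : ℤ) + (i : ℕ))) := by
    have hp : ∏ i ∈ Finset.Icc (1 : ℕ) 15, ((n : ℤ) + (i : ℕ)) =
        ∏ i ∈ Finset.range 15, ((n : ℤ) + ((1 + i : ℕ) : ℤ)) := by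
      rw [show Finset.Icc 1 15 = Finset.Ico 1 16 from rfl, Finset.prod_Ico_eq_prod_range]
    rw [h, hp, add_mul, add_mul, add_mul, add_mul, add_mul, add_mul, add_mul]
    simp only [mul_assoc, choose_prod]
    simp only [Finset.prod_range_succ, Finset.prod_range_zero]
    push_cast
    ring
  have hf : (Nat.factorial 22 : ℤ) = 44 * (5 * 2 * 3 * 7 * Nat.factorial 19) := by
    norm_num [Nat.factorial]
  rw [hf] at key
  have key2 : (cnt leads n : ℤ) * (5 * 2 * 3 * 7 * Nat.factorial 19) =
      ((5 * n ^ 4 + 160 * n ^ 3 + 2107 * n ^ 2 + 13232 * n + 38760) *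
          ((n + 7) * (n + 8) * (n + 9)) * ∏ i ∈ Finset.Icc (1 : ℕ) 15, ((n : ℤ) + (i : ℕ))) := by
    refine mul_left_cancel₀ (show (44 : ℤ) ≠ 0 by norm_num) ?_
    rw [← key]
    ring
  exact_mod_cast key2

end counting

section final

/-- The list of positions describes the leading monomial. -/
def leadMatch (j : Fin 18) (l : List (Fin 32)) : Bool :=
  (List.finRange 32).all fun p => Nat.beq (dig (gbe j).1 p) (bif l.elem p then 1 else 0)

theorem leadMatch_spec {j : Fin 18} {l : List (Fin 32)} (h : leadMatch j l = true) (m : Mon) :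
    (¬ gl j ≤ m) ↔ ∃ p ∈ l, m (pe.symm p) = 0 := by
  have h' : ∀ p : Fin 32, dig (gbe j).1 p = bif l.elem p then 1 else 0 := fun p =>
    Nat.eq_of_beq_eq_true (List.all_eq_true.1 h p (List.mem_finRange p))
  rw [Finsupp.le_def]
  push Not
  constructor
  · rintro ⟨S, hS⟩
    rw [gl, dec_apply, h'] at hS
    cases hl : l.elem (pe S) with
    | false => rw [hl] at hS; simp at hS
    | true =>
      rw [hl, cond_true] at hS
      refine ⟨pe S, by simpa using hl, ?_⟩
      rw [Equiv.symm_apply_apply]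
      omega
  · rintro ⟨p, hp, h0⟩
    refine ⟨pe.symm p, ?_⟩
    have hl : l.elem p = true := by simpa using hp
    rw [gl, dec_apply, Equiv.apply_symm_apply, h', hl, h0]
    simp

theorem leads_match : (leads.all fun l => (List.finRange 18).any fun j => leadMatch j l) = true := by
  decide +kernel

theorem match_leads : ((List.finRange 18).all fun j => leads.any fun l => leadMatch j l) = true := by
  decide +kernel

theorem std_iff (m : Mon) : IsStd gl m ↔ surv leads m := by
  constructor
  · intro h l hl
    obtain ⟨j, _, hj⟩ := List.any_eq_true.1 (List.all_eq_true.1 leads_match l hl)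
    exact (leadMatch_spec hj m).1 (h j)
  · intro h j
    obtain ⟨l, hl, hj⟩ := List.any_eq_true.1
      (List.all_eq_true.1 match_leads j (List.mem_finRange j))
    exact (leadMatch_spec hj m).2 (h l hl)

theorem finrank_eq_cnt
    (hI : Igrav = Ideal.span (Set.range fun j : Fin 11 => gpoly (gbe j))) (n : ℕ) :
    Module.finrank ℂ (Acomp n) = cnt leads n := by
  classical
  refine finrank_Acomp_eq (hI.trans span_GB.symm) gt_support GB_buch n _ fun m => ?_
  rw [Finset.mem_filter, Finset.mem_finsuppAntidiag, std_iff]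
  simp [dg]

end final

section degree

open Polynomial

theorem hilb_degree :
    ((5 * X ^ 4 + 160 * X ^ 3 + 2107 * X ^ 2 + 13232 * X + C 38760) *
        ((X + C 7) * (X + C 8) * (X + C 9)) *
        ∏ i ∈ Finset.Icc (1 : ℕ) 15, (X + C (i : ℚ)) : Polynomial ℚ).degree = 22 := by
  have h1 : (5 * X ^ 4 + 160 * X ^ 3 + 2107 * X ^ 2 + 13232 * X + C 38760 : Polynomial ℚ).degree
      = 4 := by
    compute_degree!
  rw [degree_mul, degree_mul, degree_mul, degree_mul, degree_prod, h1]
  simp only [degree_X_add_C, Finset.sum_const, Nat.card_Icc]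
  rfl

end degree

/-! ### The eleven quadrics -/

section wedge

variable {K A : Type*} [CommRing K] [Ring A] [Algebra K A]

/-- The generic element of degree 1. -/
def LL1 (x : Finset (Fin 5) → K) (a : Fin 5 → A) : A :=
    x {0} • (a 0) + x {1} • (a 1) + x {2} • (a 2) + x {3} • (a 3) + x {4} • (a 4)

/-- The generic element of degree 2. -/
def LL2 (x : Finset (Fin 5) → K) (a : Fin 5 → A) : A :=
    x {0,1} • (a 0 * a 1) + x {0,2} • (a 0 * a 2) + x {0,3} • (a 0 * a 3) +
    x {0,4} • (a 0 * a 4) + x {1,2} • (a 1 * a 2) + x {1,3} • (a 1 * a 3) +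
    x {1,4} • (a 1 * a 4) + x {2,3} • (a 2 * a 3) + x {2,4} • (a 2 * a 4) +
    x {3,4} • (a 3 * a 4)

/-- The generic element of degree 3. -/
def LL3 (x : Finset (Fin 5) → K) (a : Fin 5 → A) : A :=
    x {0,1,2} • (a 0 * (a 1 * a 2)) + x {0,1,3} • (a 0 * (a 1 * a 3)) +
    x {0,1,4} • (a 0 * (a 1 * a 4)) + x {0,2,3} • (a 0 * (a 2 * a 3)) +
    x {0,2,4} • (a 0 * (a 2 * a 4)) + x {0,3,4} • (a 0 * (a 3 * a 4)) +
    x {1,2,3} • (a 1 * (a 2 * a 3)) + x {1,2,4} • (a 1 * (a 2 * a 4)) +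
    x {1,3,4} • (a 1 * (a 3 * a 4)) + x {2,3,4} • (a 2 * (a 3 * a 4))

/-- The generic element of degree 4. -/
def LL4 (x : Finset (Fin 5) → K) (a : Fin 5 → A) : A :=
    x {0,1,2,3} • (a 0 * (a 1 * (a 2 * a 3))) + x {0,1,2,4} • (a 0 * (a 1 * (a 2 * a 4))) +
    x {0,1,3,4} • (a 0 * (a 1 * (a 3 * a 4))) + x {0,2,3,4} • (a 0 * (a 2 * (a 3 * a 4))) +
    x {1,2,3,4} • (a 1 * (a 2 * (a 3 * a 4)))

/-- The generic element of degree 5. -/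
def LL5 (x : Finset (Fin 5) → K) (a : Fin 5 → A) : A :=
    x {0,1,2,3,4} • (a 0 * (a 1 * (a 2 * (a 3 * a 4))))

/-- The quadric of (E1). -/
def Q1 (x : Finset (Fin 5) → K) : K :=
    x ∅ * x {0,1,2,3,4} + x {0} * x {1,2,3,4} - x {1} * x {0,2,3,4} - x {0,1} * x {2,3,4} +
    x {2} * x {0,1,3,4} + x {0,2} * x {1,3,4} - x {1,2} * x {0,3,4} - x {3} * x {0,1,2,4} -
    x {0,3} * x {1,2,4} + x {1,3} * x {0,2,4} - x {2,3} * x {0,1,4} + x {4} * x {0,1,2,3} +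
    x {0,4} * x {1,2,3} - x {1,4} * x {0,2,3} + x {2,4} * x {0,1,3} - x {3,4} * x {0,1,2}

/-- The quadrics of (E2). -/
def Q2 (x : Finset (Fin 5) → K) : Fin 5 → K := ![
    -x ∅ * x {1,2,3,4} - x {1} * x {2,3,4} + x {2} * x {1,3,4} + x {1,2} * x {3,4} -
    x {3} * x {1,2,4} - x {1,3} * x {2,4} + x {2,3} * x {1,4} + x {4} * x {1,2,3},
    -x ∅ * x {0,2,3,4} - x {0} * x {2,3,4} + x {2} * x {0,3,4} + x {0,2} * x {3,4} -
    x {3} * x {0,2,4} - x {0,3} * x {2,4} + x {2,3} * x {0,4} + x {4} * x {0,2,3},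
    -x ∅ * x {0,1,3,4} - x {0} * x {1,3,4} + x {1} * x {0,3,4} + x {0,1} * x {3,4} -
    x {3} * x {0,1,4} - x {0,3} * x {1,4} + x {1,3} * x {0,4} + x {4} * x {0,1,3},
    -x ∅ * x {0,1,2,4} - x {0} * x {1,2,4} + x {1} * x {0,2,4} + x {0,1} * x {2,4} -
    x {2} * x {0,1,4} - x {0,2} * x {1,4} + x {1,2} * x {0,4} + x {4} * x {0,1,2},
    -x ∅ * x {0,1,2,3} - x {0} * x {1,2,3} + x {1} * x {0,2,3} + x {0,1} * x {2,3} -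
    x {2} * x {0,1,3} - x {0,2} * x {1,3} + x {1,2} * x {0,3} + x {3} * x {0,1,2}]

/-- The quadrics of (E3). -/
def Q3 (x : Finset (Fin 5) → K) : Fin 5 → K := ![
    -x {0} * x {0,1,2,3,4} - x {0,1} * x {0,2,3,4} + x {0,2} * x {0,1,3,4} +
    x {0,1,2} * x {0,3,4} - x {0,3} * x {0,1,2,4} - x {0,1,3} * x {0,2,4} +
    x {0,2,3} * x {0,1,4} + x {0,4} * x {0,1,2,3},
    -x {1} * x {0,1,2,3,4} - x {0,1} * x {1,2,3,4} + x {1,2} * x {0,1,3,4} +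
    x {0,1,2} * x {1,3,4} - x {1,3} * x {0,1,2,4} - x {0,1,3} * x {1,2,4} +
    x {1,2,3} * x {0,1,4} + x {1,4} * x {0,1,2,3},
    -x {2} * x {0,1,2,3,4} - x {0,2} * x {1,2,3,4} + x {1,2} * x {0,2,3,4} +
    x {0,1,2} * x {2,3,4} - x {2,3} * x {0,1,2,4} - x {0,2,3} * x {1,2,4} +
    x {1,2,3} * x {0,2,4} + x {2,4} * x {0,1,2,3},
    -x {3} * x {0,1,2,3,4} - x {0,3} * x {1,2,3,4} + x {1,3} * x {0,2,3,4} +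
    x {0,1,3} * x {2,3,4} - x {2,3} * x {0,1,3,4} - x {0,2,3} * x {1,3,4} +
    x {1,2,3} * x {0,3,4} + x {3,4} * x {0,1,2,3},
    -x {4} * x {0,1,2,3,4} - x {0,4} * x {1,2,3,4} + x {1,4} * x {0,2,3,4} +
    x {0,1,4} * x {2,3,4} - x {2,4} * x {0,1,3,4} - x {0,2,4} * x {1,3,4} +
    x {1,2,4} * x {0,3,4} + x {3,4} * x {0,1,2,4}]

/-- The anticommutation relations. -/
structure Anti (a : Fin 5 → A) : Prop where
  sq : ∀ i, a i * a i = 0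
  sq' : ∀ i y, a i * (a i * y) = 0
  c01 : a 1 * a 0 = -(a 0 * a 1)
  d01 : ∀ y, a 1 * (a 0 * y) = -(a 0 * (a 1 * y))
  c02 : a 2 * a 0 = -(a 0 * a 2)
  d02 : ∀ y, a 2 * (a 0 * y) = -(a 0 * (a 2 * y))
  c03 : a 3 * a 0 = -(a 0 * a 3)
  d03 : ∀ y, a 3 * (a 0 * y) = -(a 0 * (a 3 * y))
  c04 : a 4 * a 0 = -(a 0 * a 4)
  d04 : ∀ y, a 4 * (a 0 * y) = -(a 0 * (a 4 * y))
  c12 : a 2 * a 1 = -(a 1 * a 2)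
  d12 : ∀ y, a 2 * (a 1 * y) = -(a 1 * (a 2 * y))
  c13 : a 3 * a 1 = -(a 1 * a 3)
  d13 : ∀ y, a 3 * (a 1 * y) = -(a 1 * (a 3 * y))
  c14 : a 4 * a 1 = -(a 1 * a 4)
  d14 : ∀ y, a 4 * (a 1 * y) = -(a 1 * (a 4 * y))
  c23 : a 3 * a 2 = -(a 2 * a 3)
  d23 : ∀ y, a 3 * (a 2 * y) = -(a 2 * (a 3 * y))
  c24 : a 4 * a 2 = -(a 2 * a 4)
  d24 : ∀ y, a 4 * (a 2 * y) = -(a 2 * (a 4 * y))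
  c34 : a 4 * a 3 = -(a 3 * a 4)
  d34 : ∀ y, a 4 * (a 3 * y) = -(a 3 * (a 4 * y))

theorem Anti.mk' {a : Fin 5 → A} (h0 : ∀ i, a i * a i = 0)
    (hc : ∀ i j, a j * a i = -(a i * a j)) : Anti a := by
  have hd : ∀ i j y, a j * (a i * y) = -(a i * (a j * y)) := fun i j y => by
    rw [← mul_assoc, hc i j, neg_mul, mul_assoc]
  constructor
  · exact h0
  · intro i y; rw [← mul_assoc, h0, zero_mul]
  all_goals first | exact hc _ _ | exact hd _ _

theorem wedge_E1 (x : Finset (Fin 5) → K) {a : Fin 5 → A} (h : Anti a) :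
    x ∅ • LL5 x a + LL1 x a * LL4 x a - LL2 x a * LL3 x a =
      Q1 x • (a 0 * (a 1 * (a 2 * (a 3 * a 4)))) := by
  unfold LL1 LL2 LL3 LL4 LL5 Q1
  simp only [one_mul, mul_add, add_mul, mul_sub, sub_mul, smul_mul_assoc, mul_smul_comm, h.sq,
    h.sq', mul_assoc, h.c01, h.d01, h.c02, h.d02, h.c03, h.d03, h.c04, h.d04, h.c12, h.d12, h.c13,
    h.d13, h.c14, h.d14, h.c23, h.d23, h.c24, h.d24, h.c34, h.d34, mul_neg, neg_mul, mul_zero,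
    neg_zero, smul_zero, neg_neg]
  module

theorem wedge_E2 (x : Finset (Fin 5) → K) {a : Fin 5 → A} (h : Anti a) :
    -(2 • (x ∅ • LL4 x a)) - 2 • (LL1 x a * LL3 x a) + LL2 x a * LL2 x a =
      (2 * Q2 x 0) • (a 1 * (a 2 * (a 3 * a 4))) +
      (2 * Q2 x 1) • (a 0 * (a 2 * (a 3 * a 4))) +
      (2 * Q2 x 2) • (a 0 * (a 1 * (a 3 * a 4))) +
      (2 * Q2 x 3) • (a 0 * (a 1 * (a 2 * a 4))) +
      (2 * Q2 x 4) • (a 0 * (a 1 * (a 2 * a 3))) := by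
  have e0 : Q2 x 0 = -x ∅ * x {1,2,3,4} - x {1} * x {2,3,4} + x {2} * x {1,3,4} + x {1,2} * x {3,4} -
    x {3} * x {1,2,4} - x {1,3} * x {2,4} + x {2,3} * x {1,4} + x {4} * x {1,2,3} := rfl
  have e1 : Q2 x 1 = -x ∅ * x {0,2,3,4} - x {0} * x {2,3,4} + x {2} * x {0,3,4} + x {0,2} * x {3,4} -
    x {3} * x {0,2,4} - x {0,3} * x {2,4} + x {2,3} * x {0,4} + x {4} * x {0,2,3} := rfl
  have e2 : Q2 x 2 = -x ∅ * x {0,1,3,4} - x {0} * x {1,3,4} + x {1} * x {0,3,4} + x {0,1} * x {3,4} -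
    x {3} * x {0,1,4} - x {0,3} * x {1,4} + x {1,3} * x {0,4} + x {4} * x {0,1,3} := rfl
  have e3 : Q2 x 3 = -x ∅ * x {0,1,2,4} - x {0} * x {1,2,4} + x {1} * x {0,2,4} + x {0,1} * x {2,4} -
    x {2} * x {0,1,4} - x {0,2} * x {1,4} + x {1,2} * x {0,4} + x {4} * x {0,1,2} := rfl
  have e4 : Q2 x 4 = -x ∅ * x {0,1,2,3} - x {0} * x {1,2,3} + x {1} * x {0,2,3} + x {0,1} * x {2,3} -
    x {2} * x {0,1,3} - x {0,2} * x {1,3} + x {1,2} * x {0,3} + x {3} * x {0,1,2} := rfl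
  rw [e0, e1, e2, e3, e4]
  unfold LL1 LL2 LL3 LL4
  simp only [one_mul, mul_add, add_mul, mul_sub, sub_mul, smul_mul_assoc, mul_smul_comm, h.sq,
    h.sq', mul_assoc, h.c01, h.d01, h.c02, h.d02, h.c03, h.d03, h.c04, h.d04, h.c12, h.d12, h.c13,
    h.d13, h.c14, h.d14, h.c23, h.d23, h.c24, h.d24, h.c34, h.d34, mul_neg, neg_mul, mul_zero,
    neg_zero, smul_zero, neg_neg]
  module

theorem wedge_E3 (x : Finset (Fin 5) → K) {a : Fin 5 → A} (h : Anti a) (d : Fin 5 → K)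
    (c : A →ₗ[K] A) (hc : ∀ i, c (a i) = d i • 1) (hc' : ∀ i y, c (a i * y) = d i • y - a i * c y) :
    -(2 • (c (LL1 x a) * LL5 x a)) + 2 • (c (LL2 x a) * LL4 x a) + c (LL3 x a) * LL3 x a =
      (2 * (d 0 * Q3 x 0 + d 1 * Q3 x 1 + d 2 * Q3 x 2 + d 3 * Q3 x 3 + d 4 * Q3 x 4)) •
        (a 0 * (a 1 * (a 2 * (a 3 * a 4)))) := by
  have e0 : Q3 x 0 = -x {0} * x {0,1,2,3,4} - x {0,1} * x {0,2,3,4} + x {0,2} * x {0,1,3,4} +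
    x {0,1,2} * x {0,3,4} - x {0,3} * x {0,1,2,4} - x {0,1,3} * x {0,2,4} +
    x {0,2,3} * x {0,1,4} + x {0,4} * x {0,1,2,3} := rfl
  have e1 : Q3 x 1 = -x {1} * x {0,1,2,3,4} - x {0,1} * x {1,2,3,4} + x {1,2} * x {0,1,3,4} +
    x {0,1,2} * x {1,3,4} - x {1,3} * x {0,1,2,4} - x {0,1,3} * x {1,2,4} +
    x {1,2,3} * x {0,1,4} + x {1,4} * x {0,1,2,3} := rfl
  have e2 : Q3 x 2 = -x {2} * x {0,1,2,3,4} - x {0,2} * x {1,2,3,4} + x {1,2} * x {0,2,3,4} +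
    x {0,1,2} * x {2,3,4} - x {2,3} * x {0,1,2,4} - x {0,2,3} * x {1,2,4} +
    x {1,2,3} * x {0,2,4} + x {2,4} * x {0,1,2,3} := rfl
  have e3 : Q3 x 3 = -x {3} * x {0,1,2,3,4} - x {0,3} * x {1,2,3,4} + x {1,3} * x {0,2,3,4} +
    x {0,1,3} * x {2,3,4} - x {2,3} * x {0,1,3,4} - x {0,2,3} * x {1,3,4} +
    x {1,2,3} * x {0,3,4} + x {3,4} * x {0,1,2,3} := rfl
  have e4 : Q3 x 4 = -x {4} * x {0,1,2,3,4} - x {0,4} * x {1,2,3,4} + x {1,4} * x {0,2,3,4} +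
    x {0,1,4} * x {2,3,4} - x {2,4} * x {0,1,3,4} - x {0,2,4} * x {1,3,4} +
    x {1,2,4} * x {0,3,4} + x {3,4} * x {0,1,2,4} := rfl
  rw [e0, e1, e2, e3, e4]
  unfold LL1 LL2 LL3 LL4 LL5
  simp only [map_add, map_smul, hc, hc', mul_one, smul_mul_assoc, one_mul, mul_smul_comm, mul_sub]
  simp only [one_mul, mul_add, add_mul, mul_sub, sub_mul, smul_mul_assoc, mul_smul_comm, h.sq,
    h.sq', mul_assoc, h.c01, h.d01, h.c02, h.d02, h.c03, h.d03, h.c04, h.d04, h.c12, h.d12, h.c13,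
    h.d13, h.c14, h.d14, h.c23, h.d23, h.c24, h.d24, h.c34, h.d34, mul_neg, neg_mul, mul_zero,
    neg_zero, smul_zero, neg_neg]
  module

end wedge

/-! ### The ideal -/

section ideal

open MvPolynomial

/-- The basis vectors. -/
def av (i : Fin 5) : Ext5 := ExteriorAlgebra.ι R32 (Pi.single i 1)

theorem anti_av : Anti av := by
  refine Anti.mk' (fun i => ExteriorAlgebra.ι_sq_zero _) (fun i j => ?_)
  exact eq_neg_of_add_eq_zero_left (ExteriorAlgebra.ι_add_mul_swap _ _)

/-- The generic coordinates. -/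
def xv (S : Finset (Fin 5)) : R32 := X S

theorem eS_singleton (i : Fin 5) : eS {i} = av i := by
  simp [eS, av]

theorem eS_insert (i : Fin 5) (S : Finset (Fin 5)) (h : ∀ b ∈ S, i < b) :
    eS (insert i S) = av i * eS S := by
  rw [eS, Finset.sort_insert _ (fun b hb => (h b hb).le) (fun hi => (h i hi).false), List.map_cons,
    List.prod_cons]
  rfl

theorem filt1 : (Finset.univ.filter (fun S : Finset (Fin 5) => S.card = 1)) =
    {{0}, {1}, {2}, {3}, {4}} := by
  decide

theorem lamb1 : lamb 1 = LL1 xv av := by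
  rw [lamb, filt1]
  rw [Finset.sum_insert (by decide),
    Finset.sum_insert (by decide),
    Finset.sum_insert (by decide),
    Finset.sum_insert (by decide), Finset.sum_singleton]
  simp only [eS_singleton, LL1, xv, add_assoc]

theorem filt2 : (Finset.univ.filter (fun S : Finset (Fin 5) => S.card = 2)) =
    {{0,1}, {0,2}, {0,3}, {0,4}, {1,2}, {1,3}, {1,4}, {2,3}, {2,4}, {3,4}} := by
  decide

theorem lamb2 : lamb 2 = LL2 xv av := by
  rw [lamb, filt2]
  rw [Finset.sum_insert (by decide),
    Finset.sum_insert (by decide),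
    Finset.sum_insert (by decide),
    Finset.sum_insert (by decide),
    Finset.sum_insert (by decide),
    Finset.sum_insert (by decide),
    Finset.sum_insert (by decide),
    Finset.sum_insert (by decide),
    Finset.sum_insert (by decide), Finset.sum_singleton]
  rw [eS_insert 0 {1} (by decide),
    eS_insert 0 {2} (by decide),
    eS_insert 0 {3} (by decide),
    eS_insert 0 {4} (by decide),
    eS_insert 1 {2} (by decide),
    eS_insert 1 {3} (by decide),
    eS_insert 1 {4} (by decide),
    eS_insert 2 {3} (by decide),
    eS_insert 2 {4} (by decide),
    eS_insert 3 {4} (by decide)]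
  simp only [eS_singleton, LL2, xv, add_assoc]

theorem filt3 : (Finset.univ.filter (fun S : Finset (Fin 5) => S.card = 3)) =
    {{0,1,2}, {0,1,3}, {0,1,4}, {0,2,3}, {0,2,4}, {0,3,4}, {1,2,3}, {1,2,4}, {1,3,4}, {2,3,4}} := by
  decide

theorem lamb3 : lamb 3 = LL3 xv av := by
  rw [lamb, filt3]
  rw [Finset.sum_insert (by decide),
    Finset.sum_insert (by decide),
    Finset.sum_insert (by decide),
    Finset.sum_insert (by decide),
    Finset.sum_insert (by decide),
    Finset.sum_insert (by decide),
    Finset.sum_insert (by decide),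
    Finset.sum_insert (by decide),
    Finset.sum_insert (by decide), Finset.sum_singleton]
  rw [eS_insert 0 {1,2} (by decide),
    eS_insert 0 {1,3} (by decide),
    eS_insert 0 {1,4} (by decide),
    eS_insert 0 {2,3} (by decide),
    eS_insert 0 {2,4} (by decide),
    eS_insert 0 {3,4} (by decide),
    eS_insert 1 {2,3} (by decide),
    eS_insert 1 {2,4} (by decide),
    eS_insert 1 {3,4} (by decide),
    eS_insert 2 {3,4} (by decide),
    eS_insert 1 {2} (by decide),
    eS_insert 1 {3} (by decide),
    eS_insert 1 {4} (by decide),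
    eS_insert 2 {3} (by decide),
    eS_insert 2 {4} (by decide),
    eS_insert 3 {4} (by decide)]
  simp only [eS_singleton, LL3, xv, add_assoc]

theorem filt4 : (Finset.univ.filter (fun S : Finset (Fin 5) => S.card = 4)) =
    {{0,1,2,3}, {0,1,2,4}, {0,1,3,4}, {0,2,3,4}, {1,2,3,4}} := by
  decide

theorem lamb4 : lamb 4 = LL4 xv av := by
  rw [lamb, filt4]
  rw [Finset.sum_insert (by decide),
    Finset.sum_insert (by decide),
    Finset.sum_insert (by decide),
    Finset.sum_insert (by decide), Finset.sum_singleton]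
  rw [eS_insert 0 {1,2,3} (by decide),
    eS_insert 0 {1,2,4} (by decide),
    eS_insert 0 {1,3,4} (by decide),
    eS_insert 0 {2,3,4} (by decide),
    eS_insert 1 {2,3,4} (by decide),
    eS_insert 1 {2,3} (by decide),
    eS_insert 1 {2,4} (by decide),
    eS_insert 1 {3,4} (by decide),
    eS_insert 2 {3,4} (by decide),
    eS_insert 2 {3} (by decide),
    eS_insert 2 {4} (by decide),
    eS_insert 3 {4} (by decide)]
  simp only [eS_singleton, LL4, xv, add_assoc]

theorem filt5 : (Finset.univ.filter (fun S : Finset (Fin 5) => S.card = 5)) =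
    {{0,1,2,3,4}} := by
  decide

theorem lamb5 : lamb 5 = LL5 xv av := by
  rw [lamb, filt5]
  rw [Finset.sum_singleton]
  rw [eS_insert 0 {1,2,3,4} (by decide),
    eS_insert 1 {2,3,4} (by decide),
    eS_insert 2 {3,4} (by decide),
    eS_insert 3 {4} (by decide)]
  simp only [eS_singleton, LL5, xv, add_assoc]

theorem ctr_av (r i : Fin 5) : ctr r (av i) = (Pi.single i (1 : R32) : Fin 5 → R32) r • 1 := by
  rw [ctr, av, ExteriorAlgebra.ι]
  rw [CliffordAlgebra.contractLeft_ι, Algebra.algebraMap_eq_smul_one]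
  rfl

theorem ctr_av_mul (r i : Fin 5) (y : Ext5) :
    ctr r (av i * y) = (Pi.single i (1 : R32) : Fin 5 → R32) r • y - av i * ctr r y := by
  rw [ctr, av, ExteriorAlgebra.ι]
  exact CliffordAlgebra.contractLeft_ι_mul _ _ _

/-- The top wedge monomial. -/
def topw : Ext5 := av 0 * (av 1 * (av 2 * (av 3 * av 4)))

theorem E1_eq : E1 = Q1 xv • topw := by
  rw [E1, lamb1, lamb2, lamb3, lamb4, lamb5]
  exact wedge_E1 xv anti_av

theorem E2_eq : E2 = (2 * Q2 xv 0) • (av 1 * (av 2 * (av 3 * av 4))) +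
    (2 * Q2 xv 1) • (av 0 * (av 2 * (av 3 * av 4))) +
    (2 * Q2 xv 2) • (av 0 * (av 1 * (av 3 * av 4))) +
    (2 * Q2 xv 3) • (av 0 * (av 1 * (av 2 * av 4))) +
    (2 * Q2 xv 4) • (av 0 * (av 1 * (av 2 * av 3))) := by
  rw [E2, lamb1, lamb2, lamb3, lamb4]
  exact wedge_E2 xv anti_av

theorem E3_eq (r : Fin 5) : E3 r = (2 * Q3 xv r) • topw := by
  rw [E3, lamb1, lamb2, lamb3, lamb4, lamb5]
  rw [wedge_E3 xv anti_av (fun i => (Pi.single i (1 : R32) : Fin 5 → R32) r) (ctr r) (ctr_av r)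
    (ctr_av_mul r)]
  rw [topw]
  congr 2
  fin_cases r <;> simp [Pi.single_apply]

/-- The top coefficient. -/
def phi : Ext5 →ₗ[R32] R32 :=
  (ExteriorAlgebra.algebraMapInv (R := R32) (M := Fin 5 → R32)).toLinearMap ∘ₗ
    ctr 4 ∘ₗ ctr 3 ∘ₗ ctr 2 ∘ₗ ctr 1 ∘ₗ ctr 0

theorem phi_topw : phi topw = 1 := by
  simp [phi, topw, ctr_av, ctr_av_mul, Pi.single_apply]

/-- The coefficients in degree four, up to sign. -/
def psi (o : Fin 5) : Ext5 →ₗ[R32] R32 := phi ∘ₗ LinearMap.mulLeft R32 (av o)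

theorem psi_E2 (o : Fin 5) : psi o E2 = (-1) ^ (o : ℕ) * (2 * Q2 xv o) := by
  have h := anti_av
  have ht := phi_topw
  rw [topw] at ht
  rw [psi, LinearMap.comp_apply, LinearMap.mulLeft_apply, E2_eq]
  fin_cases o
  all_goals
    simp only [Fin.zero_eta, Fin.mk_one, Fin.reduceFinMk]
    simp only [mul_add, mul_smul_comm, h.sq, h.sq', h.c01, h.d01, h.c02, h.d02, h.c03, h.d03, h.c04,
      h.d04, h.c12, h.d12, h.c13, h.d13, h.c14, h.d14, h.c23, h.d23, h.c24, h.d24, h.c34, h.d34,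
      mul_neg, neg_mul, mul_zero, neg_zero, smul_zero, smul_neg, neg_neg, map_add, map_neg,
      map_smul, map_zero, ht]
    first
      | (simp [ht]; done)
      | (simp [ht]; ring)

theorem mem_of_smul_top {J : Ideal R32} {E : Ext5} (hE : E ∈ J • (⊤ : Submodule R32 Ext5))
    (f : Ext5 →ₗ[R32] R32) : f E ∈ J := by
  have h : J • (⊤ : Submodule R32 Ext5) ≤ Submodule.comap f J := by
    rw [Submodule.smul_le]
    intro r hr y _
    rw [Submodule.mem_comap, map_smul, smul_eq_mul]
    exact J.mul_mem_right _ hr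
  exact h hE

theorem mem_of_two_mul {J : Ideal R32} {p : R32} (h : 2 * p ∈ J) : p ∈ J := by
  have h2 := J.mul_mem_left (C (1 / 2 : ℂ)) h
  have e : (C (1 / 2 : ℂ) : R32) * (2 * p) = p := by
    rw [← mul_assoc, show (2 : R32) = C 2 from (map_ofNat C 2).symm, ← C_mul]
    norm_num
  rwa [e] at h2

theorem Igrav_eq : Igrav = Ideal.span ({Q1 xv} ∪ Set.range (Q2 xv) ∪ Set.range (Q3 xv)) := by
  apply le_antisymm
  · refine sInf_le ?_
    have m1 : Q1 xv ∈ Ideal.span ({Q1 xv} ∪ Set.range (Q2 xv) ∪ Set.range (Q3 xv)) :=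
      Ideal.subset_span (Or.inl (Or.inl rfl))
    have m2 : ∀ o, 2 * Q2 xv o ∈ Ideal.span ({Q1 xv} ∪ Set.range (Q2 xv) ∪ Set.range (Q3 xv)) :=
      fun o => Ideal.mul_mem_left _ _ (Ideal.subset_span (Or.inl (Or.inr ⟨o, rfl⟩)))
    have m3 : ∀ o, 2 * Q3 xv o ∈ Ideal.span ({Q1 xv} ∪ Set.range (Q2 xv) ∪ Set.range (Q3 xv)) :=
      fun o => Ideal.mul_mem_left _ _ (Ideal.subset_span (Or.inr ⟨o, rfl⟩))
    refine ⟨?_, ?_, fun r => ?_⟩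
    · rw [E1_eq]; exact Submodule.smul_mem_smul m1 trivial
    · rw [E2_eq]
      exact add_mem (add_mem (add_mem (add_mem (Submodule.smul_mem_smul (m2 0) trivial)
        (Submodule.smul_mem_smul (m2 1) trivial)) (Submodule.smul_mem_smul (m2 2) trivial))
        (Submodule.smul_mem_smul (m2 3) trivial)) (Submodule.smul_mem_smul (m2 4) trivial)
    · rw [E3_eq]; exact Submodule.smul_mem_smul (m3 r) trivial
  · refine le_sInf ?_
    rintro J ⟨h1, h2, h3⟩
    rw [Ideal.span_le]
    rintro _ ((h | ⟨o, rfl⟩) | ⟨o, rfl⟩)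
    · rw [Set.mem_singleton_iff] at h
      have := mem_of_smul_top h1 phi
      rw [E1_eq, map_smul, phi_topw, smul_eq_mul, mul_one] at this
      rw [h]; exact this
    · have := mem_of_smul_top h2 (psi o)
      rw [psi_E2] at this
      have h4 := J.mul_mem_left ((-1) ^ (o : ℕ)) this
      rw [← mul_assoc, ← mul_pow, neg_one_mul, neg_neg, one_pow, one_mul] at h4
      exact mem_of_two_mul h4
    · have := mem_of_smul_top (h3 o) phi
      rw [E3_eq, map_smul, phi_topw, smul_eq_mul, mul_one] at this
      exact mem_of_two_mul this

/-- Quadratic polynomials as lists. -/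
def evQ : List (Finset (Fin 5) × Finset (Fin 5) × ℤ) → R32
  | [] => 0
  | (S, T, c) :: l => C (c : ℂ) * (X S * X T) + evQ l

/-- The comparison of a list of quadratic terms with a term list. -/
def cmpQ : List (Finset (Fin 5) × Finset (Fin 5) × ℤ) → PL → Bool
  | [], .nil => true
  | (S, T, c) :: l, .cons m d p =>
    Nat.beq (16 ^ (posF S : ℕ) + 16 ^ (posF T : ℕ)) m && ((c == d) && cmpQ l p)
  | [], .cons _ _ _ => false
  | _ :: _, .nil => false

theorem dec_pow (S : Finset (Fin 5)) : dec (16 ^ (pe S : ℕ)) = Finsupp.single S 1 := by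
  have h : ∀ p q : Fin 32, dig (16 ^ (p : ℕ)) q = if p = q then 1 else 0 := by decide +kernel
  ext T
  rw [dec_apply, h, Finsupp.single_apply]
  simp

theorem okc_pow (p : Fin 32) : okc (16 ^ (p : ℕ)) := by
  have h : ∀ p : Fin 32, okb (16 ^ (p : ℕ)) = true := by decide +kernel
  exact okb_spec (h p)

theorem cmpQ_spec (l : List (Finset (Fin 5) × Finset (Fin 5) × ℤ)) (p : PL) (h : cmpQ l p = true) :
    ev p = evQ l := by
  induction l generalizing p with
  | nil =>
    cases p with
    | nil => rfl
    | cons m d p => simp [cmpQ] at h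
  | cons x l ih =>
    obtain ⟨S, T, c⟩ := x
    cases p with
    | nil => simp [cmpQ] at h
    | cons m d p =>
      rw [cmpQ, Bool.and_eq_true, Bool.and_eq_true, beq_iff_eq] at h
      obtain ⟨h1, rfl, h2⟩ := h
      replace h1 := Nat.eq_of_beq_eq_true h1
      rw [ev, evQ, ih p h2, ← h1, ← pe_apply, ← pe_apply, dec_add (okc_pow _) (okc_pow _), dec_pow,
        dec_pow, X, X, monomial_mul, C_mul_monomial]
      simp

theorem gpoly_of_cmp {l : List (Finset (Fin 5) × Finset (Fin 5) × ℤ)} {j : ℕ}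
    (h : cmpQ l (.cons (gbe j).1 1 (gbe j).2) = true) : gpoly (gbe j) = evQ l := by
  rw [← cmpQ_spec l _ h, gpoly, ev]
  simp

theorem gpoly_0 : gpoly (gbe 0) = Q1 xv := by
  rw [gpoly_of_cmp (l := [({2,4}, {0,1,3}, 1), ({2,3}, {0,1,4}, -1), ({1,4}, {0,2,3}, -1),
      (∅, {0,1,2,3,4}, 1), ({1,3}, {0,2,4}, 1), ({0,4}, {1,2,3}, 1),
      ({4}, {0,1,2,3}, 1), ({0,3}, {1,2,4}, -1), ({3,4}, {0,1,2}, -1),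
      ({1,2}, {0,3,4}, -1), ({0}, {1,2,3,4}, 1), ({2}, {0,1,3,4}, 1),
      ({1}, {0,2,3,4}, -1), ({3}, {0,1,2,4}, -1), ({0,1}, {2,3,4}, -1),
      ({0,2}, {1,3,4}, 1)]) (by decide +kernel)]
  have e : Q1 xv = (X ∅ * X {0,1,2,3,4} + X {0} * X {1,2,3,4} - X {1} * X {0,2,3,4} - X {0,1} * X {2,3,4} + X {2} * X {0,1,3,4} + X {0,2} * X {1,3,4} - X {1,2} * X {0,3,4} - X {3} * X {0,1,2,4} - X {0,3} * X {1,2,4} + X {1,3} * X {0,2,4} - X {2,3} * X {0,1,4} + X {4} * X {0,1,2,3} + X {0,4} * X {1,2,3} - X {1,4} * X {0,2,3} + X {2,4} * X {0,1,3} - X {3,4} * X {0,1,2} : R32) := rfl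
  rw [e]
  simp only [evQ, Int.cast_one, Int.cast_neg, map_one, map_neg]
  ring

theorem gpoly_1 : gpoly (gbe 1) = Q2 xv 0 := by
  rw [gpoly_of_cmp (l := [({1,2}, {3,4}, 1), ({1,3}, {2,4}, -1), ({2,3}, {1,4}, 1),
      ({4}, {1,2,3}, 1), (∅, {1,2,3,4}, -1), ({3}, {1,2,4}, -1),
      ({1}, {2,3,4}, -1), ({2}, {1,3,4}, 1)]) (by decide +kernel)]
  have e : Q2 xv 0 = (-X ∅ * X {1,2,3,4} - X {1} * X {2,3,4} + X {2} * X {1,3,4} + X {1,2} * X {3,4} - X {3} * X {1,2,4} - X {1,3} * X {2,4} + X {2,3} * X {1,4} + X {4} * X {1,2,3} : R32) := rfl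
  rw [e]
  simp only [evQ, Int.cast_one, Int.cast_neg, map_one, map_neg]
  ring

theorem gpoly_2 : gpoly (gbe 2) = Q2 xv 1 := by
  rw [gpoly_of_cmp (l := [({0,2}, {3,4}, 1), ({2,3}, {0,4}, 1), ({0,3}, {2,4}, -1),
      ({4}, {0,2,3}, 1), ({3}, {0,2,4}, -1), ({2}, {0,3,4}, 1),
      (∅, {0,2,3,4}, -1), ({0}, {2,3,4}, -1)]) (by decide +kernel)]
  have e : Q2 xv 1 = (-X ∅ * X {0,2,3,4} - X {0} * X {2,3,4} + X {2} * X {0,3,4} + X {0,2} * X {3,4} - X {3} * X {0,2,4} - X {0,3} * X {2,4} + X {2,3} * X {0,4} + X {4} * X {0,2,3} : R32) := rfl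
  rw [e]
  simp only [evQ, Int.cast_one, Int.cast_neg, map_one, map_neg]
  ring

theorem gpoly_3 : gpoly (gbe 3) = Q2 xv 2 := by
  rw [gpoly_of_cmp (l := [({1,3}, {0,4}, 1), ({0,1}, {3,4}, 1), ({4}, {0,1,3}, 1),
      ({0,3}, {1,4}, -1), (∅, {0,1,3,4}, -1), ({3}, {0,1,4}, -1),
      ({1}, {0,3,4}, 1), ({0}, {1,3,4}, -1)]) (by decide +kernel)]
  have e : Q2 xv 2 = (-X ∅ * X {0,1,3,4} - X {0} * X {1,3,4} + X {1} * X {0,3,4} + X {0,1} * X {3,4} - X {3} * X {0,1,4} - X {0,3} * X {1,4} + X {1,3} * X {0,4} + X {4} * X {0,1,3} : R32) := rfl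
  rw [e]
  simp only [evQ, Int.cast_one, Int.cast_neg, map_one, map_neg]
  ring

theorem gpoly_4 : gpoly (gbe 4) = Q2 xv 3 := by
  rw [gpoly_of_cmp (l := [({1,2}, {0,4}, 1), ({0,1}, {2,4}, 1), ({0,2}, {1,4}, -1),
      ({1}, {0,2,4}, 1), ({4}, {0,1,2}, 1), ({0}, {1,2,4}, -1),
      ({2}, {0,1,4}, -1), (∅, {0,1,2,4}, -1)]) (by decide +kernel)]
  have e : Q2 xv 3 = (-X ∅ * X {0,1,2,4} - X {0} * X {1,2,4} + X {1} * X {0,2,4} + X {0,1} * X {2,4} - X {2} * X {0,1,4} - X {0,2} * X {1,4} + X {1,2} * X {0,4} + X {4} * X {0,1,2} : R32) := rfl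
  rw [e]
  simp only [evQ, Int.cast_one, Int.cast_neg, map_one, map_neg]
  ring

theorem gpoly_5 : gpoly (gbe 5) = -(Q2 xv 4) := by
  rw [gpoly_of_cmp (l := [({0,2}, {1,3}, 1), ({0,1}, {2,3}, -1), ({1,2}, {0,3}, -1),
      ({1}, {0,2,3}, -1), (∅, {0,1,2,3}, 1), ({3}, {0,1,2}, -1),
      ({0}, {1,2,3}, 1), ({2}, {0,1,3}, 1)]) (by decide +kernel)]
  have e : Q2 xv 4 = (-X ∅ * X {0,1,2,3} - X {0} * X {1,2,3} + X {1} * X {0,2,3} + X {0,1} * X {2,3} - X {2} * X {0,1,3} - X {0,2} * X {1,3} + X {1,2} * X {0,3} + X {3} * X {0,1,2} : R32) := rfl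
  rw [e]
  simp only [evQ, Int.cast_one, Int.cast_neg, map_one, map_neg]
  ring

theorem gpoly_6 : gpoly (gbe 6) = Q3 xv 0 := by
  rw [gpoly_of_cmp (l := [({0,2,3}, {0,1,4}, 1), ({0,1,3}, {0,2,4}, -1), ({0,2}, {0,1,3,4}, 1),
      ({0,4}, {0,1,2,3}, 1), ({0,1,2}, {0,3,4}, 1), ({0}, {0,1,2,3,4}, -1),
      ({0,1}, {0,2,3,4}, -1), ({0,3}, {0,1,2,4}, -1)]) (by decide +kernel)]
  have e : Q3 xv 0 = (-X {0} * X {0,1,2,3,4} - X {0,1} * X {0,2,3,4} + X {0,2} * X {0,1,3,4} + X {0,1,2} * X {0,3,4} - X {0,3} * X {0,1,2,4} - X {0,1,3} * X {0,2,4} + X {0,2,3} * X {0,1,4} + X {0,4} * X {0,1,2,3} : R32) := rfl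
  rw [e]
  simp only [evQ, Int.cast_one, Int.cast_neg, map_one, map_neg]
  ring

theorem gpoly_7 : gpoly (gbe 7) = -(Q3 xv 1) := by
  rw [gpoly_of_cmp (l := [({1}, {0,1,2,3,4}, 1), ({1,2,3}, {0,1,4}, -1), ({0,1}, {1,2,3,4}, 1),
      ({1,2}, {0,1,3,4}, -1), ({1,4}, {0,1,2,3}, -1), ({0,1,3}, {1,2,4}, 1),
      ({1,3}, {0,1,2,4}, 1), ({0,1,2}, {1,3,4}, -1)]) (by decide +kernel)]
  have e : Q3 xv 1 = (-X {1} * X {0,1,2,3,4} - X {0,1} * X {1,2,3,4} + X {1,2} * X {0,1,3,4} + X {0,1,2} * X {1,3,4} - X {1,3} * X {0,1,2,4} - X {0,1,3} * X {1,2,4} + X {1,2,3} * X {0,1,4} + X {1,4} * X {0,1,2,3} : R32) := rfl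
  rw [e]
  simp only [evQ, Int.cast_one, Int.cast_neg, map_one, map_neg]
  ring

theorem gpoly_8 : gpoly (gbe 8) = Q3 xv 2 := by
  rw [gpoly_of_cmp (l := [({1,2,3}, {0,2,4}, 1), ({0,2}, {1,2,3,4}, -1), ({2,4}, {0,1,2,3}, 1),
      ({0,2,3}, {1,2,4}, -1), ({2}, {0,1,2,3,4}, -1), ({1,2}, {0,2,3,4}, 1),
      ({2,3}, {0,1,2,4}, -1), ({0,1,2}, {2,3,4}, 1)]) (by decide +kernel)]
  have e : Q3 xv 2 = (-X {2} * X {0,1,2,3,4} - X {0,2} * X {1,2,3,4} + X {1,2} * X {0,2,3,4} + X {0,1,2} * X {2,3,4} - X {2,3} * X {0,1,2,4} - X {0,2,3} * X {1,2,4} + X {1,2,3} * X {0,2,4} + X {2,4} * X {0,1,2,3} : R32) := rfl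
  rw [e]
  simp only [evQ, Int.cast_one, Int.cast_neg, map_one, map_neg]
  ring

theorem gpoly_9 : gpoly (gbe 9) = -(Q3 xv 3) := by
  rw [gpoly_of_cmp (l := [({0,3}, {1,2,3,4}, 1), ({2,3}, {0,1,3,4}, 1), ({3}, {0,1,2,3,4}, 1),
      ({3,4}, {0,1,2,3}, -1), ({1,2,3}, {0,3,4}, -1), ({1,3}, {0,2,3,4}, -1),
      ({0,1,3}, {2,3,4}, -1), ({0,2,3}, {1,3,4}, 1)]) (by decide +kernel)]
  have e : Q3 xv 3 = (-X {3} * X {0,1,2,3,4} - X {0,3} * X {1,2,3,4} + X {1,3} * X {0,2,3,4} + X {0,1,3} * X {2,3,4} - X {2,3} * X {0,1,3,4} - X {0,2,3} * X {1,3,4} + X {1,2,3} * X {0,3,4} + X {3,4} * X {0,1,2,3} : R32) := rfl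
  rw [e]
  simp only [evQ, Int.cast_one, Int.cast_neg, map_one, map_neg]
  ring

theorem gpoly_10 : gpoly (gbe 10) = -(Q3 xv 4) := by
  rw [gpoly_of_cmp (l := [({4}, {0,1,2,3,4}, 1), ({0,4}, {1,2,3,4}, 1), ({2,4}, {0,1,3,4}, 1),
      ({1,2,4}, {0,3,4}, -1), ({1,4}, {0,2,3,4}, -1), ({3,4}, {0,1,2,4}, -1),
      ({0,1,4}, {2,3,4}, -1), ({0,2,4}, {1,3,4}, 1)]) (by decide +kernel)]
  have e : Q3 xv 4 = (-X {4} * X {0,1,2,3,4} - X {0,4} * X {1,2,3,4} + X {1,4} * X {0,2,3,4} + X {0,1,4} * X {2,3,4} - X {2,4} * X {0,1,3,4} - X {0,2,4} * X {1,3,4} + X {1,2,4} * X {0,3,4} + X {3,4} * X {0,1,2,4} : R32) := rfl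
  rw [e]
  simp only [evQ, Int.cast_one, Int.cast_neg, map_one, map_neg]
  ring

theorem Igrav_span : Igrav = Ideal.span (Set.range fun j : Fin 11 => gpoly (gbe j)) := by
  rw [Igrav_eq]
  have hs : ∀ j : Fin 11, gpoly (gbe j) ∈ Ideal.span (Set.range fun j : Fin 11 => gpoly (gbe j)) :=
    fun j => Ideal.subset_span ⟨j, rfl⟩
  have hq : ∀ j : Fin 11, gpoly (gbe j) ∈
      Ideal.span ({Q1 xv} ∪ Set.range (Q2 xv) ∪ Set.range (Q3 xv)) := by
    have m1 : Q1 xv ∈ Ideal.span ({Q1 xv} ∪ Set.range (Q2 xv) ∪ Set.range (Q3 xv)) :=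
      Ideal.subset_span (Or.inl (Or.inl rfl))
    have m2 : ∀ o, Q2 xv o ∈ Ideal.span ({Q1 xv} ∪ Set.range (Q2 xv) ∪ Set.range (Q3 xv)) :=
      fun o => Ideal.subset_span (Or.inl (Or.inr ⟨o, rfl⟩))
    have m3 : ∀ o, Q3 xv o ∈ Ideal.span ({Q1 xv} ∪ Set.range (Q2 xv) ∪ Set.range (Q3 xv)) :=
      fun o => Ideal.subset_span (Or.inr ⟨o, rfl⟩)
    intro j
    fin_cases j
    · exact gpoly_0 ▸ m1
    · exact gpoly_1 ▸ m2 0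
    · exact gpoly_2 ▸ m2 1
    · exact gpoly_3 ▸ m2 2
    · exact gpoly_4 ▸ m2 3
    · exact gpoly_5 ▸ neg_mem (m2 4)
    · exact gpoly_6 ▸ m3 0
    · exact gpoly_7 ▸ neg_mem (m3 1)
    · exact gpoly_8 ▸ m3 2
    · exact gpoly_9 ▸ neg_mem (m3 3)
    · exact gpoly_10 ▸ neg_mem (m3 4)
  apply le_antisymm
  · rw [Ideal.span_le]
    rintro _ ((h | ⟨o, rfl⟩) | ⟨o, rfl⟩)
    · rw [Set.mem_singleton_iff] at h
      rw [h]
      exact gpoly_0 ▸ hs 0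
    · fin_cases o
      · exact gpoly_1 ▸ hs 1
      · exact gpoly_2 ▸ hs 2
      · exact gpoly_3 ▸ hs 3
      · exact gpoly_4 ▸ hs 4
      · exact neg_mem_iff.1 (gpoly_5 ▸ hs 5)
    · fin_cases o
      · exact gpoly_6 ▸ hs 6
      · exact neg_mem_iff.1 (gpoly_7 ▸ hs 7)
      · exact gpoly_8 ▸ hs 8
      · exact neg_mem_iff.1 (gpoly_9 ▸ hs 9)
      · exact neg_mem_iff.1 (gpoly_10 ▸ hs 10)
  · rw [Ideal.span_le]
    rintro _ ⟨j, rfl⟩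
    exact hq j

end ideal

open Polynomial in
/-- for every `n ≥ 0`,
`dim A_n = (5n⁴+160n³+2107n²+13232n+38760)·(n+7)(n+8)(n+9)·(n+1)⋯(n+15) / (5·2·3·7·19!)`
(stated with the denominator cleared); in particular the Hilbert polynomial has degree 22. -/
theorem gravSpinor_hilbert_function :
    (∀ n : ℕ,
      Module.finrank ℂ (Acomp n) * (5 * 2 * 3 * 7 * Nat.factorial 19) =
        (5 * n ^ 4 + 160 * n ^ 3 + 2107 * n ^ 2 + 13232 * n + 38760) *
          ((n + 7) * (n + 8) * (n + 9)) * ∏ i ∈ Finset.Icc 1 15, (n + i)) ∧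
    ((5 * X ^ 4 + 160 * X ^ 3 + 2107 * X ^ 2 + 13232 * X + C 38760) *
        ((X + C 7) * (X + C 8) * (X + C 9)) *
        ∏ i ∈ Finset.Icc (1 : ℕ) 15, (X + C (i : ℚ)) : Polynomial ℚ).degree = 22 := by
  exact ⟨fun n => by rw [finrank_eq_cnt Igrav_span n]; exact cnt_formula n, hilb_degree⟩
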